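/- arXiv:2410.11515 — 3 statements merged into one kernel-verified Lean document; each statement's English description precedes it below -/
import Mathlib

section
/- Fix α with 1 < α < 3/2 and let the random fields be i.i.d. symmetric Bernoulli (P(h_i = 1) = P(h_i = −1) = 1/2). Then there exist h₀ > 0 and β₀ > 0 such that for every field strength h with 0 < h ≤ h₀ and every inverse temperature β ≥ β₀, the long-range order parameter satisfies m² > 0. -/
open MeasureTheory ProbabilityTheory Filter
open scoped Classical

noncomputable section

/-- The spin value (±1) of a Boolean configuration entry. -/
def spin (b : Bool) : ℝ := if b then 1 else -1

/-- The total spin `S_{n,1} = Σ_i σ_i` of a configuration of `2^n` spins. -/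
def totalSpin (n : ℕ) (σ : Fin (2^n) → Bool) : ℝ := ∑ i, spin (σ i)

/-- The Dyson hierarchical Hamiltonian `H_N`, defined recursively:
`H_0 = 0`, `H_{N}(σ) = H_{N-1}(σ₁) + H_{N-1}(σ₂) - 2^{-αN} Σ_{i,j} σ_i σ_j`. -/
def dysonH (α : ℝ) : (N : ℕ) → (Fin (2^N) → Bool) → ℝ
  | 0, _ => 0
  | (N+1), σ =>
      dysonH α N (fun i => σ ⟨i.1, by have := i.2; rw [pow_succ]; omega⟩)
    + dysonH α N (fun i => σ ⟨2^N + i.1, by have := i.2; rw [pow_succ]; omega⟩)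
    - (2:ℝ) ^ (-(α * ((N:ℝ)+1))) *
        ∑ i : Fin (2^(N+1)), ∑ j : Fin (2^(N+1)), spin (σ i) * spin (σ j)

/-- The random-field Hamiltonian `H_N^{RF}(σ) = H_N(σ) - h Σ_i h_i σ_i`,
where `fh` is the field strength and `η` the realization of the random fields. -/
def dysonHRF (α fh : ℝ) (N : ℕ) (η : Fin (2^N) → ℝ) (σ : Fin (2^N) → Bool) : ℝ :=
  dysonH α N σ - fh * ∑ i, η i * spin (σ i)

/-- The Gibbs average `⟨F⟩_N` with weight `exp(-β H_N^{RF}(σ))`. -/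
def gibbs (α β fh : ℝ) (N : ℕ) (η : Fin (2^N) → ℝ) (F : (Fin (2^N) → Bool) → ℝ) : ℝ :=
  (∑ σ, F σ * Real.exp (-β * dysonHRF α fh N η σ)) /
    ∑ σ, Real.exp (-β * dysonHRF α fh N η σ)

/-- The law of `n` i.i.d. standard Gaussian random fields. -/
def gaussianFields (n : ℕ) : Measure (Fin n → ℝ) :=
  Measure.pi fun _ => gaussianReal 0 1

/-- Expectation with respect to `n` i.i.d. symmetric Bernoulli (±1) random fields,
i.e. the uniform average over `{-1,+1}^n`. -/
def bernoulliExp (n : ℕ) (F : (Fin n → ℝ) → ℝ) : ℝ :=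
  ((2:ℝ)^n)⁻¹ * ∑ ε : Fin n → Bool, F (fun i => spin (ε i))

/-- `f_N = 2^{-2N} E[⟨S_{N,1}²⟩_N]` with i.i.d. standard Gaussian random fields. -/
def fG (α β fh : ℝ) (N : ℕ) : ℝ :=
  ((2:ℝ)^(2*N))⁻¹ *
    ∫ η, gibbs α β fh N η (fun σ => (totalSpin N σ)^2) ∂ gaussianFields (2^N)

/-- `f_N = 2^{-2N} E[⟨S_{N,1}²⟩_N]` with i.i.d. symmetric Bernoulli random fields. -/
def fB (α β fh : ℝ) (N : ℕ) : ℝ :=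
  ((2:ℝ)^(2*N))⁻¹ *
    bernoulliExp (2^N) (fun η => gibbs α β fh N η (fun σ => (totalSpin N σ)^2))

/-- `b_n = 2^{(2-α)n}`. -/
def bcoef (α : ℝ) (n : ℕ) : ℝ := (2:ℝ) ^ (((2:ℝ) - α) * n)

/-- The first half `(h_1, …, h_{2^{N-1}})` of the random fields. -/
def half1 (N : ℕ) (η : Fin (2^N) → ℝ) : Fin (2^(N-1)) → ℝ :=
  fun i => η ⟨i.1, lt_of_lt_of_le i.2 (Nat.pow_le_pow_right (by norm_num) (Nat.sub_le N 1))⟩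

/-- The second half `(h_{2^{N-1}+1}, …, h_{2^N})` of the random fields. -/
def half2 (N : ℕ) (η : Fin (2^N) → ℝ) : Fin (2^(N-1)) → ℝ :=
  fun i => if hlt : 2^(N-1) + i.1 < 2^N then η ⟨2^(N-1) + i.1, hlt⟩ else 0

/-- Membership in the `k`-th of the `r` equal subintervals `I_k` of `[-2^{N-1}, 2^{N-1}]`. -/
def inBlock (N r k : ℕ) (x : ℝ) : Prop :=
  -(2:ℝ)^(N-1) + ((k:ℝ)-1) * ((2:ℝ)^N / r) ≤ x ∧
    x ≤ -(2:ℝ)^(N-1) + (k:ℝ) * ((2:ℝ)^N / r)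

/-- The restricted partition function
`Z_k(η) = Σ_{σ : S_{N-1} ∈ I_k} exp(-β H_{N-1}^{RF}(σ) + 2β b_N 2^{-2N} S_{N-1}²)`,
on `2^{N-1}` spins with fields `η`. Both `Z_{k,1}` and `Z_{k,2}` are this function,
applied to the first resp. second half of the random fields. -/
def Zres (α β fh : ℝ) (N r k : ℕ) (η : Fin (2^(N-1)) → ℝ) : ℝ :=
  ∑ σ : Fin (2^(N-1)) → Bool,
    if inBlock N r k (totalSpin (N-1) σ) then
      Real.exp (-β * dysonHRF α fh (N-1) η σ
        + 2 * β * bcoef α N * ((2:ℝ)^(2*N))⁻¹ * (totalSpin (N-1) σ)^2)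
    else 0

/-- `g_k = log (Z_{k,1}(h₁) / Z_{k,2}(h₂))` as a function of all the random fields. -/
def gk (α β fh : ℝ) (N r k : ℕ) (η : Fin (2^N) → ℝ) : ℝ :=
  Real.log (Zres α β fh N r k (half1 N η) / Zres α β fh N r k (half2 N η))

/-- `max_{1 ≤ k ≤ r} g_k`. -/
def maxgk (α β fh : ℝ) (N r : ℕ) (hr : 1 ≤ r) (η : Fin (2^N) → ℝ) : ℝ :=
  (Finset.Icc 1 r).sup' (Finset.nonempty_Icc.mpr hr) (fun k => gk α β fh N r k η)

/-- The sum of the spins in the `B`-th consecutive block of size `2^n` (out of `2^{N-n}`). -/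
def blockSum (N n : ℕ) (σ : Fin (2^N) → Bool) (B : Fin (2^(N-n))) : ℝ :=
  ∑ j : Fin (2^n), if hlt : B.1 * 2^n + j.1 < 2^N then spin (σ ⟨B.1 * 2^n + j.1, hlt⟩) else 0

/-- The generalized pressure
`P_N(v_N, …, v_1) = log Σ_σ exp(Σ_{n=1}^N v_n Σ_B (Σ_{i∈B} σ_i)² + β h Σ_i h_i σ_i)`
for a given realization `η` of the random fields; the quenched pressure is its
expectation over the fields. -/
def pressure (β fh : ℝ) (N : ℕ) (v : ℕ → ℝ) (η : Fin (2^N) → ℝ) : ℝ :=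
  Real.log (∑ σ : Fin (2^N) → Bool,
    Real.exp ((∑ n ∈ Finset.Icc 1 N, v n * ∑ B : Fin (2^(N-n)), (blockSum N n σ B)^2)
      + β * fh * ∑ i, η i * spin (σ i)))

/-- The couplings `v_n = β b_n 2^{-2n}` corresponding to `-β H_N`. -/
def vcoup (α β : ℝ) (n : ℕ) : ℝ := β * bcoef α n * ((2:ℝ)^(2*n))⁻¹

/-- `f_N = 2^{-2N} ⟨S_{N,1}²⟩_N` without random field. -/
def fNoField (α β : ℝ) (N : ℕ) : ℝ :=
  ((2:ℝ)^(2*N))⁻¹ * gibbs α β 0 N (fun _ => 0) (fun σ => (totalSpin N σ)^2)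

/-- The `p`-th term of the series bounding `1 - f_N` from above. -/
def seriesTerm (α β fh c : ℝ) (p : ℕ) : ℝ :=
  (1/(β * bcoef α p)) * (β/c + Real.log (2 * Real.sqrt (c * bcoef α p))
    + β * fh * (2:ℝ)^((p:ℝ)/2) *
      Real.log (2 * Real.sqrt (c * bcoef α p) * (1 + Real.sqrt (2*Real.pi*Real.exp 1))))

namespace RF

def lft {X : Type} (n : ℕ) (σ : Fin (2^(n+1)) → X) : Fin (2^n) → X :=
  fun i => σ ⟨i.1, by have := i.2; rw [pow_succ]; omega⟩

def rgt {X : Type} (n : ℕ) (σ : Fin (2^(n+1)) → X) : Fin (2^n) → X :=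
  fun i => σ ⟨2^n + i.1, by have := i.2; rw [pow_succ]; omega⟩

def finE (n : ℕ) : Fin (2^n) ⊕ Fin (2^n) ≃ Fin (2^(n+1)) :=
  finSumFinEquiv.trans (finCongr (by rw [pow_succ]; omega))

def joinE (n : ℕ) : (Fin (2^(n+1)) → Bool) ≃ (Fin (2^n) → Bool) × (Fin (2^n) → Bool) :=
  ((finE n).arrowCongr (Equiv.refl Bool)).symm.trans (Equiv.sumArrowEquivProdArrow _ _ _)

lemma joinE_apply (n : ℕ) (σ : Fin (2^(n+1)) → Bool) : joinE n σ = (lft n σ, rgt n σ) := by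
  rfl

lemma sum_join (n : ℕ) (f : (Fin (2^n) → Bool) → (Fin (2^n) → Bool) → ℝ) :
    ∑ σ : Fin (2^(n+1)) → Bool, f (lft n σ) (rgt n σ) = ∑ σ, ∑ τ, f σ τ := by
  rw [← Fintype.sum_prod_type' f]
  exact Fintype.sum_equiv (joinE n) _ _ (fun σ => by rw [joinE_apply])

lemma sum_fin (n : ℕ) (g : Fin (2^(n+1)) → ℝ) :
    ∑ i, g i = ∑ i, lft n g i + ∑ i, rgt n g i := by
  rw [← Equiv.sum_comp (finE n) g, Fintype.sum_sum_type]
  rfl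

lemma totalSpin_split (n : ℕ) (σ : Fin (2^(n+1)) → Bool) :
    totalSpin (n+1) σ = totalSpin n (lft n σ) + totalSpin n (rgt n σ) := by
  unfold totalSpin
  rw [sum_fin]
  rfl

def vv (α : ℝ) (n : ℕ) : ℝ := (2:ℝ) ^ (-(α * ((n:ℝ)+1)))

lemma dysonH_split (α : ℝ) (n : ℕ) (σ : Fin (2^(n+1)) → Bool) :
    dysonH α (n+1) σ = dysonH α n (lft n σ) + dysonH α n (rgt n σ)
      - vv α n * (totalSpin n (lft n σ) + totalSpin n (rgt n σ))^2 := by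
  rw [← totalSpin_split, dysonH]
  simp only [← Finset.mul_sum, ← Finset.sum_mul, sq]
  rfl

lemma hrf_split (α fh : ℝ) (n : ℕ) (ε : Fin (2^(n+1)) → Bool) (σ : Fin (2^(n+1)) → Bool) :
    dysonHRF α fh (n+1) (fun i => spin (ε i)) σ =
      dysonHRF α fh n (fun i => spin (lft n ε i)) (lft n σ)
      + dysonHRF α fh n (fun i => spin (rgt n ε i)) (rgt n σ)
      - vv α n * (totalSpin n (lft n σ) + totalSpin n (rgt n σ))^2 := by
  unfold dysonHRF
  rw [dysonH_split, sum_fin]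
  have h1 : lft n (fun i => spin (ε i) * spin (σ i)) =
    fun i => spin (lft n ε i) * spin (lft n σ i) := rfl
  have h2 : rgt n (fun i => spin (ε i) * spin (σ i)) =
    fun i => spin (rgt n ε i) * spin (rgt n σ i) := rfl
  rw [h1, h2]
  ring

def w (α β fh : ℝ) (n : ℕ) (ε σ : Fin (2^n) → Bool) : ℝ :=
  Real.exp (-β * dysonHRF α fh n (fun i => spin (ε i)) σ)

lemma w_pos (α β fh : ℝ) (n : ℕ) (ε σ : Fin (2^n) → Bool) : 0 < w α β fh n ε σ :=
  Real.exp_pos _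

lemma w_split (α β fh : ℝ) (n : ℕ) (ε σ : Fin (2^(n+1)) → Bool) :
    w α β fh (n+1) ε σ = w α β fh n (lft n ε) (lft n σ) * w α β fh n (rgt n ε) (rgt n σ)
      * Real.exp (β * vv α n * (totalSpin n (lft n σ) + totalSpin n (rgt n σ))^2) := by
  unfold w
  rw [hrf_split, ← Real.exp_add, ← Real.exp_add]
  congr 1
  ring

/-- log-convex kernels -/
def LC (K : ℝ → ℝ) : Prop := (∀ x, 0 < K x) ∧ ∀ x y, (K ((x+y)/2))^2 ≤ K x * K y

lemma LC.sum {ι : Type*} [Fintype ι] [Nonempty ι] (K : ι → ℝ → ℝ) (h : ∀ i, LC (K i)) :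
    LC (fun x => ∑ i, K i x) := by
  refine ⟨fun x => Finset.sum_pos (fun i _ => (h i).1 x) Finset.univ_nonempty, fun x y => ?_⟩
  exact Finset.sum_sq_le_sum_mul_sum_of_sq_le_mul _ (fun i _ => ((h i).1 x).le)
    (fun i _ => ((h i).1 y).le) (fun i _ => (h i).2 x y)

lemma LC.shift {K : ℝ → ℝ} (h : LC K) (a c v : ℝ) (hc : 0 < c) (hv : 0 ≤ v) :
    LC (fun x => c * Real.exp (v * (x + a)^2) * K (x + a)) := by
  refine ⟨fun x => by have := h.1 (x+a); positivity, fun x y => ?_⟩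
  have h1 := h.2 (x+a) (y+a)
  have e1 : (x + a + (y + a))/2 = (x+y)/2 + a := by ring
  rw [e1] at h1
  have h2 : (Real.exp (v * ((x+y)/2 + a)^2))^2 ≤
      Real.exp (v * (x + a)^2) * Real.exp (v * (y + a)^2) := by
    rw [← Real.exp_nat_mul, ← Real.exp_add]
    apply Real.exp_le_exp.mpr
    push_cast
    nlinarith [mul_nonneg hv (sq_nonneg (x - y))]
  calc (c * Real.exp (v * ((x+y)/2 + a)^2) * K ((x+y)/2 + a))^2
      = c^2 * ((Real.exp (v * ((x+y)/2 + a)^2))^2 * (K ((x+y)/2 + a))^2) := by ring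
    _ ≤ c^2 * ((Real.exp (v * (x + a)^2) * Real.exp (v * (y + a)^2)) * (K (x+a) * K (y+a))) := by
        gcongr
    _ = _ := by ring

/-- Set of values of the total spin. -/
def T (n : ℕ) : Finset ℝ := Finset.univ.image (totalSpin n)

lemma card_T (n : ℕ) : ((T n).card : ℝ) ≤ 2^(n+1) := by
  have h : T n ⊆ (Finset.range (2^n+1)).image (fun k : ℕ => 2 * (k:ℝ) - 2^n) := by
    intro x hx
    simp only [T, Finset.mem_image, Finset.mem_univ, true_and] at hx
    obtain ⟨σ, rfl⟩ := hx
    simp only [Finset.mem_image, Finset.mem_range]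
    refine ⟨(Finset.univ.filter (fun i => σ i = true)).card, ?_, ?_⟩
    · have := Finset.card_filter_le (Finset.univ : Finset (Fin (2^n))) (fun i => σ i = true)
      simp at this
      omega
    · unfold totalSpin
      have : ∀ i, spin (σ i) = 2 * (if σ i = true then (1:ℝ) else 0) - 1 := by
        intro i; unfold spin; split_ifs <;> norm_num
      simp only [this, Finset.sum_sub_distrib, ← Finset.mul_sum]
      simp
  have h1 := (Finset.card_le_card h).trans Finset.card_image_le
  rw [Finset.card_range] at h1
  have h2 : (T n).card ≤ 2^(n+1) := by
    have := Nat.one_le_two_pow (n := n)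
    rw [pow_succ]; omega
  exact_mod_cast h2

lemma T_nonempty (n : ℕ) : (T n).Nonempty := Finset.univ_nonempty.image _

lemma one_le_card_T (n : ℕ) : (1:ℝ) ≤ ((T n).card : ℝ) := by
  exact_mod_cast (T_nonempty n).card_pos

def U (α β fh : ℝ) (n : ℕ) (s : ℝ) (ε : Fin (2^n) → Bool) : ℝ :=
  ∑ σ ∈ Finset.univ.filter (fun σ => totalSpin n σ = s), w α β fh n ε σ

lemma U_pos (α β fh : ℝ) (n : ℕ) {s : ℝ} (hs : s ∈ T n) (ε : Fin (2^n) → Bool) :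
    0 < U α β fh n s ε := by
  apply Finset.sum_pos (fun _ _ => w_pos ..)
  simp only [T, Finset.mem_image, Finset.mem_univ, true_and] at hs
  obtain ⟨σ, h⟩ := hs
  exact ⟨σ, by simp [h]⟩

lemma sum_fib (α β fh : ℝ) (n : ℕ) (ε : Fin (2^n) → Bool) (f : ℝ → ℝ) :
    ∑ σ, w α β fh n ε σ * f (totalSpin n σ) = ∑ s ∈ T n, U α β fh n s ε * f s := by
  rw [← Finset.sum_fiberwise_of_maps_to (s := Finset.univ) (t := T n) (g := totalSpin n)
    (fun σ _ => Finset.mem_image_of_mem _ (Finset.mem_univ _))]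
  refine Finset.sum_congr rfl fun s _ => ?_
  rw [U, Finset.sum_mul]
  refine Finset.sum_congr rfl fun σ hσ => ?_
  rw [(Finset.mem_filter.mp hσ).2]

lemma sum_fib2 (α β fh : ℝ) (n : ℕ) (ε ε' : Fin (2^n) → Bool) (f : ℝ → ℝ → ℝ) :
    ∑ σ, ∑ τ, w α β fh n ε σ * w α β fh n ε' τ * f (totalSpin n σ) (totalSpin n τ) =
      ∑ s ∈ T n, ∑ t ∈ T n, U α β fh n s ε * U α β fh n t ε' * f s t := by
  have h1 : ∀ σ, ∑ τ, w α β fh n ε σ * w α β fh n ε' τ * f (totalSpin n σ) (totalSpin n τ)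
      = w α β fh n ε σ * ∑ t ∈ T n, U α β fh n t ε' * f (totalSpin n σ) t := by
    intro σ
    rw [← sum_fib, Finset.mul_sum]
    exact Finset.sum_congr rfl fun _ _ => by ring
  simp only [h1]
  rw [sum_fib α β fh n ε (fun s => ∑ t ∈ T n, U α β fh n t ε' * f s t)]
  refine Finset.sum_congr rfl fun s _ => ?_
  rw [Finset.mul_sum]
  exact Finset.sum_congr rfl fun _ _ => by ring

lemma two_mul_le {x p q : ℝ} (hp : 0 ≤ p) (hq : 0 ≤ q) (h : x^2 ≤ p * q) : x ≤ (p + q)/2 := by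
  refine abs_le_of_sq_le_sq' ?_ (by positivity) |>.2
  nlinarith [sq_nonneg (p - q)]

/-- Core inequality. -/
lemma core (A B : ℝ → ℝ) (K : ℝ → ℝ) (hK : LC K) (R : Finset ℝ) (v c : ℝ) (hc : 0 ≤ c)
    (hA : ∀ s ∈ R, 0 < A s) (hB : ∀ s ∈ R, 0 < B s)
    (hAB : ∀ s ∈ R, A s ≤ c * B s) (hBA : ∀ s ∈ R, B s ≤ c * A s) :
    ∑ s ∈ R, ∑ t ∈ R, A s * B t * (Real.exp (2*v*(s^2+t^2)) * K (s+t)) ≤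
     ((R.card:ℝ) * c) * ∑ s ∈ R, ∑ t ∈ R, A s * B t * (Real.exp (v*(s+t)^2) * K (s+t)) := by
  have hKp := hK.1
  set p : ℝ → ℝ := fun s => A s * B s * (Real.exp (v*(s+s)^2) * K (s+s)) with hp
  have hpp : ∀ s ∈ R, 0 ≤ p s := fun s hs => by
    have := hA s hs; have := hB s hs; have := hKp (s+s); simp only [hp]; positivity
  have key : ∀ s ∈ R, ∀ t ∈ R, A s * B t * (Real.exp (2*v*(s^2+t^2)) * K (s+t)) ≤
      (c * p s + c * p t)/2 := by
    intro s hs t ht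
    apply two_mul_le (mul_nonneg hc (hpp s hs)) (mul_nonneg hc (hpp t ht))
    have hk := hK.2 (s+s) (t+t)
    have e1 : (s + s + (t + t))/2 = s + t := by ring
    rw [e1] at hk
    have a1 := hA s hs
    have a2 := hA t ht
    have b1 := hB s hs
    have b2 := hB t ht
    have k1 := hKp (s+s)
    have k2 := hKp (t+t)
    have ee : (Real.exp (2*v*(s^2+t^2)))^2 =
        Real.exp (v*(s+s)^2) * Real.exp (v*(t+t)^2) := by
      rw [← Real.exp_nat_mul, ← Real.exp_add]; congr 1; push_cast; ring
    have h1 : A s * A s ≤ c * (A s * B s) := by nlinarith [hAB s hs]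
    have h2 : B t * B t ≤ c * (A t * B t) := by nlinarith [hBA t ht]
    calc (A s * B t * (Real.exp (2*v*(s^2+t^2)) * K (s+t)))^2
        = (A s * A s) * (B t * B t) * (Real.exp (2*v*(s^2+t^2)))^2 * (K (s+t))^2 := by ring
      _ ≤ (c * (A s * B s)) * (c * (A t * B t)) * (Real.exp (2*v*(s^2+t^2)))^2
            * (K (s+s) * K (t+t)) := by gcongr
      _ = (c * p s) * (c * p t) := by rw [ee]; simp only [hp]; ring
  calc _ ≤ ∑ s ∈ R, ∑ t ∈ R, (c * p s + c * p t)/2 :=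
        Finset.sum_le_sum fun s hs => Finset.sum_le_sum fun t ht => key s hs t ht
    _ = (R.card:ℝ) * c * ∑ s ∈ R, p s := by
        simp only [add_div, Finset.sum_add_distrib, Finset.sum_const, nsmul_eq_mul,
          mul_div_assoc, ← Finset.mul_sum, ← Finset.sum_div]
        ring
    _ ≤ _ := by
        apply mul_le_mul_of_nonneg_left _ (by positivity)
        refine Finset.sum_le_sum fun s hs => ?_
        apply Finset.single_le_sum
          (f := fun t => A s * B t * (Real.exp (v*(s+t)^2) * K (s+t))) _ hs
        intro t ht
        have := hA s hs; have := hB t ht; have := hKp (s+t); positivity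

def g (α β fh : ℝ) (n : ℕ) (s : ℝ) (ε ε' : Fin (2^n) → Bool) : ℝ :=
  Real.log (U α β fh n s ε) - Real.log (U α β fh n s ε')

def lam (β fh : ℝ) (n : ℕ) : ℝ := (β * fh * Real.sqrt (2^n))⁻¹

def Y (α β fh : ℝ) (n : ℕ) (ε ε' : Fin (2^n) → Bool) : ℝ :=
  ∑ s ∈ T n, (Real.exp (lam β fh n * g α β fh n s ε ε') +
    Real.exp (lam β fh n * g α β fh n s ε' ε))

def M (α β fh : ℝ) (n : ℕ) (ε ε' : Fin (2^n) → Bool) : ℝ :=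
  (lam β fh n)⁻¹ * Real.log (Y α β fh n ε ε')

lemma Y_symm (α β fh : ℝ) (n : ℕ) (ε ε' : Fin (2^n) → Bool) :
    Y α β fh n ε ε' = Y α β fh n ε' ε := by
  unfold Y; exact Finset.sum_congr rfl fun _ _ => add_comm _ _

lemma lam_pos {β fh : ℝ} (hβ : 0 < β) (hf : 0 < fh) (n : ℕ) : 0 < lam β fh n := by
  unfold lam; positivity

lemma U_le (α : ℝ) {β fh : ℝ} (hβ : 0 < β) (hf : 0 < fh) (n : ℕ) (ε ε' : Fin (2^n) → Bool)
    {s : ℝ} (hs : s ∈ T n) :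
    U α β fh n s ε ≤ Real.exp (M α β fh n ε ε') * U α β fh n s ε' := by
  have hl := lam_pos hβ hf n
  have h1 : Real.exp (lam β fh n * g α β fh n s ε ε') ≤ Y α β fh n ε ε' := by
    unfold Y
    refine le_trans ?_ (Finset.single_le_sum (f := fun s =>
      (Real.exp (lam β fh n * g α β fh n s ε ε') +
    Real.exp (lam β fh n * g α β fh n s ε' ε))) (fun _ _ => by positivity) hs)
    linarith [Real.exp_pos (lam β fh n * g α β fh n s ε' ε)]
  have h2 : lam β fh n * g α β fh n s ε ε' ≤ Real.log (Y α β fh n ε ε') := by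
    rw [Real.le_log_iff_exp_le (lt_of_lt_of_le (Real.exp_pos _) h1)]; exact h1
  have h3 : g α β fh n s ε ε' ≤ M α β fh n ε ε' := by
    unfold M
    rw [inv_mul_eq_div, le_div_iff₀ hl]; linarith
  have p1 := U_pos α β fh n hs ε
  have p2 := U_pos α β fh n hs ε'
  rw [← Real.log_le_log_iff p1 (by positivity), Real.log_mul (Real.exp_pos _).ne' p2.ne',
    Real.log_exp]
  unfold g at h3
  linarith

def lC (α β fh : ℝ) (n : ℕ) (ε ε' : Fin (2^n) → Bool) : ℝ :=
  Real.log ((T n).card) + M α β fh n ε ε'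

def D (α β fh : ℝ) : (n : ℕ) → (Fin (2^n) → Bool) → ℝ
  | 0, _ => 0
  | (n+1), ε => (1/2) * D α β fh n (lft n ε) + (1/2) * D α β fh n (rgt n ε)
      + (β * vv α n * 4^(n+1))⁻¹ * lC α β fh n (lft n ε) (rgt n ε)

lemma vv_pos (α : ℝ) (n : ℕ) : 0 < vv α n := by unfold vv; positivity

lemma diff_bound (α : ℝ) {β fh : ℝ} (hβ : 0 < β) (hf : 0 < fh) (n : ℕ)
    (K : ℝ → ℝ) (hK : LC K) (ε ε' : Fin (2^n) → Bool) :
    ∑ σ, ∑ τ, w α β fh n ε σ * w α β fh n ε' τ * ((β * vv α n *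
        (totalSpin n σ - totalSpin n τ)^2) * (Real.exp (β * vv α n * (totalSpin n σ + totalSpin n τ)^2)
          * K (totalSpin n σ + totalSpin n τ))) ≤
    lC α β fh n ε ε' * ∑ σ, ∑ τ, w α β fh n ε σ * w α β fh n ε' τ *
       (Real.exp (β * vv α n * (totalSpin n σ + totalSpin n τ)^2)
          * K (totalSpin n σ + totalSpin n τ)) := by
  rw [sum_fib2 α β fh n ε ε' (fun s t => ((β * vv α n *
        (s - t)^2) * (Real.exp (β * vv α n * (s + t)^2) * K (s + t)))),
    sum_fib2 α β fh n ε ε' (fun s t => (Real.exp (β * vv α n * (s + t)^2) * K (s + t)))]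
  set v := β * vv α n with hv
  set C := ((T n).card:ℝ) * Real.exp (M α β fh n ε ε') with hC
  have hc1 := one_le_card_T n
  have hCpos : 0 < C := by positivity
  have hlC : lC α β fh n ε ε' = Real.log C := by
    rw [hC, Real.log_mul (by linarith) (Real.exp_pos _).ne', Real.log_exp]; rfl
  have hcore := core (fun s => U α β fh n s ε) (fun s => U α β fh n s ε') K hK (T n) v
    (Real.exp (M α β fh n ε ε')) (Real.exp_pos _).le (fun s hs => U_pos α β fh n hs ε)
    (fun s hs => U_pos α β fh n hs ε') (fun s hs => U_le α hβ hf n ε ε' hs)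
    (fun s hs => by
      have := U_le α hβ hf n ε' ε hs
      unfold M at this ⊢
      rwa [Y_symm] at this)
  rw [← hC] at hcore
  set Z := ∑ s ∈ T n, ∑ t ∈ T n, U α β fh n s ε * U α β fh n t ε' *
    (Real.exp (v * (s + t)^2) * K (s + t)) with hZ
  set Z2 := ∑ s ∈ T n, ∑ t ∈ T n, U α β fh n s ε * U α β fh n t ε' *
    (Real.exp (2 * v * (s^2 + t^2)) * K (s + t)) with hZ2
  have step : ∑ s ∈ T n, ∑ t ∈ T n, U α β fh n s ε * U α β fh n t ε' *
      (v * (s - t)^2 * (Real.exp (v * (s + t)^2) * K (s + t))) ≤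
      (Real.log C - 1) * Z + C⁻¹ * Z2 := by
    rw [hZ, hZ2, Finset.mul_sum, Finset.mul_sum, ← Finset.sum_add_distrib]
    refine Finset.sum_le_sum fun s hs => ?_
    rw [Finset.mul_sum, Finset.mul_sum, ← Finset.sum_add_distrib]
    refine Finset.sum_le_sum fun t ht => ?_
    have p1 := U_pos α β fh n hs ε
    have p2 := U_pos α β fh n ht ε'
    have p3 := hK.1 (s+t)
    have e1 : Real.exp (2 * v * (s^2 + t^2)) =
        Real.exp (v * (s+t)^2) * Real.exp (v * (s-t)^2) := by
      rw [← Real.exp_add]; congr 1; ring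
    have e2 : v * (s-t)^2 ≤ Real.log C - 1 + C⁻¹ * Real.exp (v * (s-t)^2) := by
      have := Real.add_one_le_exp (v * (s-t)^2 - Real.log C)
      rw [Real.exp_sub, Real.exp_log hCpos] at this
      rw [inv_mul_eq_div]; linarith
    rw [e1]
    have hW : 0 ≤ U α β fh n s ε * U α β fh n t ε' * (Real.exp (v * (s+t)^2) * K (s+t)) := by
      positivity
    calc _ = (v * (s-t)^2) * (U α β fh n s ε * U α β fh n t ε' *
            (Real.exp (v * (s+t)^2) * K (s+t))) := by ring
      _ ≤ _ := mul_le_mul_of_nonneg_right e2 hW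
      _ = _ := by ring
  have : C⁻¹ * Z2 ≤ Z := by
    rw [inv_mul_le_iff₀ hCpos]; exact hcore
  rw [hlC]
  linarith

lemma main (α : ℝ) {β fh : ℝ} (hβ : 0 < β) (hf : 0 < fh) (n : ℕ) :
    ∀ (K : ℝ → ℝ), LC K → ∀ ε : Fin (2^n) → Bool,
    ∑ σ, w α β fh n ε σ * ((1 - (totalSpin n σ)^2 / 4^n) * K (totalSpin n σ)) ≤
      D α β fh n ε * ∑ σ, w α β fh n ε σ * K (totalSpin n σ) := by
  induction n with
  | zero =>
    intro K hK ε
    rw [D, zero_mul]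
    apply le_of_eq
    apply Finset.sum_eq_zero
    intro σ _
    have : (totalSpin 0 σ)^2 = 1 := by
      unfold totalSpin spin
      have : ∑ i : Fin (2^0), (if σ i = true then (1:ℝ) else -1) = if σ 0 = true then 1 else -1 :=
        Fin.sum_univ_one _
      rw [this]
      split_ifs <;> norm_num
    rw [this]; simp
  | succ n ih =>
    intro K hK ε
    set v := β * vv α n with hv
    have hvp : 0 < v := mul_pos hβ (vv_pos α n)
    set ε1 := lft n ε
    set ε2 := rgt n ε
    let S := totalSpin n
    let G : ℝ → ℝ → ℝ := fun s t => Real.exp (v * (s+t)^2) * K (s+t)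
    have hK1 : LC (fun x => ∑ τ, w α β fh n ε2 τ * Real.exp (v * (x + S τ)^2) * K (x + S τ)) :=
      LC.sum (fun τ x => w α β fh n ε2 τ * Real.exp (v * (x + S τ)^2) * K (x + S τ))
        (fun τ => hK.shift (S τ) _ v (w_pos ..) hvp.le)
    have hK2 : LC (fun x => ∑ τ, w α β fh n ε1 τ * Real.exp (v * (x + S τ)^2) * K (x + S τ)) :=
      LC.sum (fun τ x => w α β fh n ε1 τ * Real.exp (v * (x + S τ)^2) * K (x + S τ))
        (fun τ => hK.shift (S τ) _ v (w_pos ..) hvp.le)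
    have i1 := ih _ hK1 ε1
    have i2 := ih _ hK2 ε2
    have i3 := diff_bound α hβ hf n K hK ε1 ε2
    set Z := ∑ σ, ∑ τ, w α β fh n ε1 σ * w α β fh n ε2 τ * G (S σ) (S τ) with hZ
    have z0 : ∑ σ, w α β fh (n+1) ε σ * K (totalSpin (n+1) σ) = Z := by
      rw [hZ, ← sum_join]
      refine Finset.sum_congr rfl fun σ _ => ?_
      rw [w_split, totalSpin_split]
      simp only [G, S]
      ring
    have z1 : ∑ σ, w α β fh n ε1 σ * (∑ τ, w α β fh n ε2 τ * Real.exp (v * (totalSpin n σ + S τ)^2)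
        * K (totalSpin n σ + S τ)) = Z := by
      rw [hZ]
      refine Finset.sum_congr rfl fun σ _ => ?_
      rw [Finset.mul_sum]
      refine Finset.sum_congr rfl fun τ _ => ?_
      simp only [G, S]; ring
    have z2 : ∑ σ, w α β fh n ε2 σ * (∑ τ, w α β fh n ε1 τ * Real.exp (v * (totalSpin n σ + S τ)^2)
        * K (totalSpin n σ + S τ)) = Z := by
      rw [hZ, Finset.sum_comm]
      refine Finset.sum_congr rfl fun σ _ => ?_
      rw [Finset.mul_sum]
      refine Finset.sum_congr rfl fun τ _ => ?_
      simp only [G, S]; rw [add_comm (totalSpin n τ)]; ring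
    rw [z1] at i1
    rw [z2] at i2
    rw [z0]
    have l1 : ∑ σ, w α β fh n ε1 σ * ((1 - (totalSpin n σ)^2/4^n) * (∑ τ, w α β fh n ε2 τ *
        Real.exp (v * (totalSpin n σ + S τ)^2) * K (totalSpin n σ + S τ))) =
        ∑ σ, ∑ τ, w α β fh n ε1 σ * w α β fh n ε2 τ * ((1 - (S σ)^2/4^n) * G (S σ) (S τ)) := by
      refine Finset.sum_congr rfl fun σ _ => ?_
      rw [Finset.mul_sum, Finset.mul_sum]
      refine Finset.sum_congr rfl fun τ _ => ?_
      simp only [G, S]; ring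
    have l2 : ∑ σ, w α β fh n ε2 σ * ((1 - (totalSpin n σ)^2/4^n) * (∑ τ, w α β fh n ε1 τ *
        Real.exp (v * (totalSpin n σ + S τ)^2) * K (totalSpin n σ + S τ))) =
        ∑ σ, ∑ τ, w α β fh n ε1 σ * w α β fh n ε2 τ * ((1 - (S τ)^2/4^n) * G (S σ) (S τ)) := by
      rw [Finset.sum_comm]
      refine Finset.sum_congr rfl fun σ _ => ?_
      rw [Finset.mul_sum, Finset.mul_sum]
      refine Finset.sum_congr rfl fun τ _ => ?_
      simp only [G, S]; rw [add_comm (totalSpin n τ)]; ring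
    rw [l1] at i1
    rw [l2] at i2
    have hL : ∑ σ, w α β fh (n+1) ε σ * ((1 - (totalSpin (n+1) σ)^2 / 4^(n+1)) *
        K (totalSpin (n+1) σ)) =
        (1/2) * (∑ σ, ∑ τ, w α β fh n ε1 σ * w α β fh n ε2 τ *
            ((1 - (S σ)^2/4^n) * G (S σ) (S τ)))
        + (1/2) * (∑ σ, ∑ τ, w α β fh n ε1 σ * w α β fh n ε2 τ *
            ((1 - (S τ)^2/4^n) * G (S σ) (S τ)))
        + (v * 4^(n+1))⁻¹ * (∑ σ, ∑ τ, w α β fh n ε1 σ * w α β fh n ε2 τ *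
            ((v * (S σ - S τ)^2) * G (S σ) (S τ))) := by
      simp only [Finset.mul_sum, ← Finset.sum_add_distrib]
      rw [← sum_join]
      refine Finset.sum_congr rfl fun σ _ => ?_
      rw [w_split, totalSpin_split]
      simp only [G, S, ε1, ε2, ← hv]
      have hv0 : v ≠ 0 := hvp.ne'
      field_simp
      ring
    rw [hL, D]
    have hq : 0 < (v * 4^(n+1))⁻¹ := by positivity
    have i3' := mul_le_mul_of_nonneg_left i3 hq.le
    simp only [G, S] at *
    rw [← hv] at *
    linarith

/-! ### Concentration -/

lemma mcd (c l : ℝ) (m : ℕ) : ∀ F : (Fin m → Bool) → ℝ,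
    (∀ x y, F x ≤ F y + c * ∑ i, |spin (x i) - spin (y i)|) →
    ∑ x, Real.exp (l * (F x - ((2:ℝ)^m)⁻¹ * ∑ y, F y)) ≤ 2^m * Real.exp (l^2 * c^2 * m / 2) := by
  induction m with
  | zero => intro F _; simp
  | succ m ih =>
    intro F hF
    have hsum : ∀ f : (Fin (m+1) → Bool) → ℝ, ∑ x, f x =
        ∑ x, f (Fin.cons true x) + ∑ x, f (Fin.cons false x) := by
      intro f
      rw [← Equiv.sum_comp (Fin.consEquiv (fun _ => Bool)) f, Fintype.sum_prod_type]
      simp [Fin.consEquiv]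
    have hb : ∀ b : Bool, ∀ x y : Fin m → Bool, F (Fin.cons b x) ≤ F (Fin.cons b y) +
        c * ∑ i, |spin (x i) - spin (y i)| := by
      intro b x y
      have := hF (Fin.cons b x) (Fin.cons b y)
      rw [Fin.sum_univ_succ] at this
      simpa using this
    have h1 := ih _ (hb true)
    have h2 := ih _ (hb false)
    set a := ((2:ℝ)^m)⁻¹ * ∑ y, F (Fin.cons true y) with ha
    set b := ((2:ℝ)^m)⁻¹ * ∑ y, F (Fin.cons false y) with hb'
    have hmean : ((2:ℝ)^(m+1))⁻¹ * ∑ y, F y = (a + b)/2 := by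
      rw [hsum F, ha, hb', pow_succ]
      field_simp
    have card : ∑ y : Fin m → Bool, (2*c) = 2^m * (2*c) := by simp
    have hab : a ≤ b + 2 * c := by
      have : ∑ y, F (Fin.cons true y) ≤ ∑ y : Fin m → Bool, (F (Fin.cons false y) + 2*c) := by
        refine Finset.sum_le_sum fun y _ => ?_
        have := hF (Fin.cons true y) (Fin.cons false y)
        rw [Fin.sum_univ_succ] at this
        simp [spin] at this
        norm_num at this
        linarith
      rw [Finset.sum_add_distrib, card] at this
      have h3 := mul_le_mul_of_nonneg_left this (by positivity : (0:ℝ) ≤ ((2:ℝ)^m)⁻¹)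
      rw [mul_add, inv_mul_cancel_left₀ (by positivity)] at h3
      exact h3
    have hba : b ≤ a + 2 * c := by
      have : ∑ y, F (Fin.cons false y) ≤ ∑ y : Fin m → Bool, (F (Fin.cons true y) + 2*c) := by
        refine Finset.sum_le_sum fun y _ => ?_
        have := hF (Fin.cons false y) (Fin.cons true y)
        rw [Fin.sum_univ_succ] at this
        simp [spin] at this
        norm_num at this
        linarith
      rw [Finset.sum_add_distrib, card] at this
      have h3 := mul_le_mul_of_nonneg_left this (by positivity : (0:ℝ) ≤ ((2:ℝ)^m)⁻¹)
      rw [mul_add, inv_mul_cancel_left₀ (by positivity)] at h3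
      exact h3
    rw [hmean, hsum]
    have e1 : ∑ x, Real.exp (l * (F (Fin.cons true x) - (a+b)/2)) =
        Real.exp (l * ((a - b)/2)) * ∑ x, Real.exp (l * (F (Fin.cons true x) - a)) := by
      rw [Finset.mul_sum]
      refine Finset.sum_congr rfl fun x _ => ?_
      rw [← Real.exp_add]; congr 1; ring
    have e2 : ∑ x, Real.exp (l * (F (Fin.cons false x) - (a+b)/2)) =
        Real.exp (-(l * ((a - b)/2))) * ∑ x, Real.exp (l * (F (Fin.cons false x) - b)) := by
      rw [Finset.mul_sum]
      refine Finset.sum_congr rfl fun x _ => ?_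
      rw [← Real.exp_add]; congr 1; ring
    rw [e1, e2]
    set Q := 2^m * Real.exp (l^2 * c^2 * m / 2) with hQ
    have hcosh := Real.cosh_le_exp_half_sq (l * ((a-b)/2))
    rw [Real.cosh_eq] at hcosh
    have hd : ((a-b)/2)^2 ≤ c^2 := sq_le_sq' (by linarith) (by linarith)
    have hle : Real.exp ((l * ((a-b)/2))^2/2) ≤ Real.exp (l^2*c^2/2) := by
      apply Real.exp_le_exp.mpr
      rw [mul_pow]
      have := mul_le_mul_of_nonneg_left hd (sq_nonneg l)
      linarith
    have hQ0 : 0 ≤ Q := by positivity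
    calc _ ≤ Real.exp (l * ((a - b)/2)) * Q + Real.exp (-(l * ((a - b)/2))) * Q := by gcongr
      _ = Q * (2 * ((Real.exp (l * ((a - b)/2)) + Real.exp (-(l * ((a - b)/2))))/2)) := by ring
      _ ≤ Q * (2 * Real.exp (l^2*c^2/2)) := by
          gcongr; linarith
      _ = _ := by
          rw [hQ]
          have : l^2 * c^2 * ((m+1 : ℕ):ℝ)/2 = l^2*c^2*m/2 + l^2*c^2/2 := by push_cast; ring
          rw [this, Real.exp_add]; ring

lemma mcd2 (c l : ℝ) (m : ℕ) (F : (Fin m → Bool) → ℝ)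
    (hF : ∀ x y, F x ≤ F y + c * ∑ i, |spin (x i) - spin (y i)|) :
    ∑ x, ∑ y, Real.exp (l * (F x - F y)) ≤ (2^m)^2 * Real.exp (l^2 * c^2 * m) := by
  have h1 := mcd c l m F hF
  have h2 := mcd c (-l) m F hF
  set μ := ((2:ℝ)^m)⁻¹ * ∑ y, F y
  have : ∑ x, ∑ y, Real.exp (l * (F x - F y)) =
      (∑ x, Real.exp (l * (F x - μ))) * ∑ y, Real.exp (-l * (F y - μ)) := by
    rw [Finset.sum_mul_sum]
    refine Finset.sum_congr rfl fun x _ => Finset.sum_congr rfl fun y _ => ?_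
    rw [← Real.exp_add]; congr 1; ring
  rw [this]
  calc _ ≤ (2^m * Real.exp (l^2 * c^2 * m / 2)) * (2^m * Real.exp ((-l)^2 * c^2 * m / 2)) := by
        apply mul_le_mul h1 h2 (Finset.sum_nonneg fun _ _ => (Real.exp_pos _).le) (by positivity)
    _ = _ := by
        have : l^2 * c^2 * m = l^2 * c^2 * m/2 + (-l)^2 * c^2 * m / 2 := by ring
        rw [this, Real.exp_add]; ring

lemma abs_spin (b : Bool) : |spin b| = 1 := by
  cases b <;> simp [spin]

lemma U_lip (α : ℝ) {β fh : ℝ} (hβ : 0 < β) (hf : 0 < fh) (n : ℕ) {s : ℝ} (hs : s ∈ T n)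
    (x y : Fin (2^n) → Bool) :
    Real.log (U α β fh n s x) ≤ Real.log (U α β fh n s y)
      + (β * fh) * ∑ i, |spin (x i) - spin (y i)| := by
  have p1 := U_pos α β fh n hs x
  have p2 := U_pos α β fh n hs y
  set d := (β * fh) * ∑ i, |spin (x i) - spin (y i)| with hd
  have : U α β fh n s x ≤ U α β fh n s y * Real.exp d := by
    unfold U
    rw [Finset.sum_mul]
    refine Finset.sum_le_sum fun σ _ => ?_
    unfold w
    rw [← Real.exp_add]
    apply Real.exp_le_exp.mpr
    unfold dysonHRF
    have h1 : ∑ i, spin (x i) * spin (σ i) - ∑ i, spin (y i) * spin (σ i) ≤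
        ∑ i, |spin (x i) - spin (y i)| := by
      rw [← Finset.sum_sub_distrib]
      refine Finset.sum_le_sum fun i _ => ?_
      rw [← sub_mul]
      refine (le_abs_self _).trans ?_
      rw [abs_mul, abs_spin, mul_one]
    have h2 := mul_le_mul_of_nonneg_left h1 (mul_pos hβ hf).le
    rw [hd]
    nlinarith
  have h := Real.log_le_log p1 this
  rwa [Real.log_mul p2.ne' (Real.exp_pos _).ne', Real.log_exp] at h

lemma Y_mean (α : ℝ) {β fh : ℝ} (hβ : 0 < β) (hf : 0 < fh) (n : ℕ) :
    ∑ x, ∑ y, Y α β fh n x y ≤ ((2:ℝ)^(2^n))^2 * (2^(n+2) * Real.exp 1) := by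
  have hl : (lam β fh n)^2 * (β * fh)^2 * ((2^n : ℕ):ℝ) = 1 := by
    unfold lam
    rw [inv_pow, mul_pow, Real.sq_sqrt (by positivity)]
    push_cast
    field_simp
  have h0 : ∀ s ∈ T n, ∑ x, ∑ y, Real.exp (lam β fh n * g α β fh n s x y) ≤
      ((2:ℝ)^(2^n))^2 * Real.exp 1 := by
    intro s hs
    have := mcd2 (β * fh) (lam β fh n) (2^n) (fun x => Real.log (U α β fh n s x))
      (U_lip α hβ hf n hs)
    rwa [hl] at this
  have h1 : ∑ x, ∑ y, Y α β fh n x y = ∑ s ∈ T n,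
      (∑ x, ∑ y, Real.exp (lam β fh n * g α β fh n s x y) +
        ∑ x, ∑ y, Real.exp (lam β fh n * g α β fh n s x y)) := by
    unfold Y
    have : ∀ s, ∑ x, ∑ y, Real.exp (lam β fh n * g α β fh n s x y) =
      ∑ x, ∑ y, Real.exp (lam β fh n * g α β fh n s y x) := fun s => Finset.sum_comm
    rw [Finset.sum_congr rfl (fun x _ => Finset.sum_comm), Finset.sum_comm]
    refine Finset.sum_congr rfl fun s _ => ?_
    nth_rewrite 2 [this s]
    simp only [Finset.sum_add_distrib]
  rw [h1]
  calc _ ≤ ∑ s ∈ T n, (2 * (((2:ℝ)^(2^n))^2 * Real.exp 1)) :=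
        Finset.sum_le_sum fun s hs => by linarith [h0 s hs]
    _ = ((T n).card:ℝ) * (2 * (((2:ℝ)^(2^n))^2 * Real.exp 1)) := by simp
    _ ≤ 2^(n+1) * (2 * (((2:ℝ)^(2^n))^2 * Real.exp 1)) := by
        gcongr; exact card_T n
    _ = _ := by ring

lemma log_two_pow_le (k : ℕ) : Real.log ((2:ℝ)^k) ≤ k := by
  rw [Real.log_pow]
  have := Real.log_two_lt_d9
  have hk : (0:ℝ) ≤ k := by positivity
  nlinarith

lemma Y_pos (α β fh : ℝ) (n : ℕ) (x y : Fin (2^n) → Bool) : 0 < Y α β fh n x y :=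
  Finset.sum_pos (fun _ _ => by positivity) (T_nonempty n)

lemma lC_mean (α : ℝ) {β fh : ℝ} (hβ : 0 < β) (hf : 0 < fh) (n : ℕ) :
    ∑ x, ∑ y, lC α β fh n x y ≤ ((2:ℝ)^(2^n))^2 *
      ((n + 3) + β * fh * Real.sqrt (2^n) * (n + 3)) := by
  set a : ℝ := 2^(n+2) * Real.exp 1 with ha
  have hap : 0 < a := by positivity
  have hla : Real.log a ≤ n + 3 := by
    rw [ha, Real.log_mul (by positivity) (by positivity), Real.log_exp]
    have := log_two_pow_le (n+2)
    push_cast at this; linarith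
  have hlc : Real.log ((T n).card) ≤ n + 3 := by
    have h1 := Real.log_le_log (by linarith [one_le_card_T n]) (card_T n)
    have := log_two_pow_le (n+1)
    push_cast at this; linarith
  have hpt : ∀ x y, Real.log (Y α β fh n x y) ≤ (Real.log a - 1) + a⁻¹ * Y α β fh n x y := by
    intro x y
    have hy := Y_pos α β fh n x y
    have := Real.log_le_sub_one_of_pos (div_pos hy hap)
    rw [Real.log_div hy.ne' hap.ne'] at this
    rw [inv_mul_eq_div]; linarith
  have hsumlog : ∑ x, ∑ y, Real.log (Y α β fh n x y) ≤ ((2:ℝ)^(2^n))^2 * (n+3) := by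
    calc _ ≤ ∑ x, ∑ y, ((Real.log a - 1) + a⁻¹ * Y α β fh n x y) :=
          Finset.sum_le_sum fun x _ => Finset.sum_le_sum fun y _ => hpt x y
      _ = ((2:ℝ)^(2^n))^2 * (Real.log a - 1) + a⁻¹ * ∑ x, ∑ y, Y α β fh n x y := by
          simp only [Finset.sum_add_distrib, ← Finset.mul_sum]
          simp
          ring
      _ ≤ ((2:ℝ)^(2^n))^2 * (Real.log a - 1) + a⁻¹ * (((2:ℝ)^(2^n))^2 * a) := by
          gcongr; exact Y_mean α hβ hf n
      _ = ((2:ℝ)^(2^n))^2 * Real.log a := by field_simp; ring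
      _ ≤ _ := by gcongr
  have hli : (lam β fh n)⁻¹ = β * fh * Real.sqrt (2^n) := by unfold lam; rw [inv_inv]
  unfold lC M
  rw [hli]
  simp only [Finset.sum_add_distrib, ← Finset.mul_sum]
  rw [mul_add]
  apply add_le_add
  · simp
    rw [← mul_assoc, ← sq]
    gcongr
  · calc _ ≤ β * fh * Real.sqrt (2^n) * (((2:ℝ)^(2^n))^2 * (n+3)) := by gcongr
      _ = _ := by ring

def av (n : ℕ) (f : (Fin (2^n) → Bool) → ℝ) : ℝ := ((2:ℝ)^(2^n))⁻¹ * ∑ x, f x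

lemma D_step (α : ℝ) {β fh : ℝ} (hβ : 0 < β) (hf : 0 < fh) (n : ℕ) :
    av (n+1) (D α β fh (n+1)) ≤ av n (D α β fh n) +
      (β * vv α n * 4^(n+1))⁻¹ * ((n + 3) + β * fh * Real.sqrt (2^n) * (n + 3)) := by
  have hvp := vv_pos α n
  have h1 := lC_mean α hβ hf n
  unfold av
  have e : (2:ℝ)^(2^(n+1)) = ((2:ℝ)^(2^n))^2 := by rw [← pow_mul, pow_succ 2 n]
  rw [e]
  set q : ℝ := (2:ℝ)^(2^n) with hq
  have hqp : 0 < q := by positivity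
  have h2 : ∑ x, D α β fh (n+1) x = q * ∑ x, D α β fh n x +
      (β * vv α n * 4^(n+1))⁻¹ * ∑ x, ∑ y, lC α β fh n x y := by
    simp only [D]
    rw [sum_join n (fun x y => (1/2) * D α β fh n x + (1/2) * D α β fh n y
      + (β * vv α n * 4^(n+1))⁻¹ * lC α β fh n x y)]
    simp only [Finset.sum_add_distrib, ← Finset.mul_sum]
    simp [← Finset.mul_sum]
    rw [← hq]; ring
  rw [h2]
  calc _ ≤ (q^2)⁻¹ * (q * ∑ x, D α β fh n x + (β * vv α n * 4^(n+1))⁻¹ *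
        (q^2 * ((n + 3) + β * fh * Real.sqrt (2^n) * (n + 3)))) := by gcongr
    _ = _ := by field_simp

def qq (α : ℝ) : ℝ := (2:ℝ)^(α - 3/2)

lemma coef_le (α : ℝ) (hα2 : α < 3/2) {β fh : ℝ} (hβ : 0 < β) (hf : 0 < fh) (n : ℕ) :
    (β * vv α n * 4^(n+1))⁻¹ * ((n + 3) + β * fh * Real.sqrt (2^n) * (n + 3)) ≤
      (β⁻¹ + fh) * ((n + 3) * qq α ^ n) := by
  have hvp := vv_pos α n
  have h4 : (4:ℝ)^(n+1) = (2:ℝ)^(2*((n:ℝ)+1)) := by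
    rw [Real.rpow_mul (by norm_num)]
    norm_num
    rw [← Real.rpow_natCast]; push_cast; rfl
  have hb : vv α n * 4^(n+1) = (2:ℝ)^((2-α)*((n:ℝ)+1)) := by
    unfold vv
    rw [h4, ← Real.rpow_add (by norm_num)]
    congr 1; ring
  have hqn : qq α ^ n = (2:ℝ)^((α-3/2)*n) := by
    unfold qq
    rw [← Real.rpow_natCast, ← Real.rpow_mul (by norm_num)]
  have hs : Real.sqrt (2^n) = (2:ℝ)^((n:ℝ)/2) := by
    rw [Real.sqrt_eq_rpow, ← Real.rpow_natCast, ← Real.rpow_mul (by norm_num)]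
    congr 1; ring
  have hn : (0:ℝ) ≤ n := by positivity
  have hB : (vv α n * 4^(n+1))⁻¹ * Real.sqrt (2^n) ≤ qq α ^ n := by
    rw [hb, hqn, hs, ← Real.rpow_neg (by norm_num), ← Real.rpow_add (by norm_num)]
    apply Real.rpow_le_rpow_of_exponent_le (by norm_num)
    nlinarith
  have hs1 : 1 ≤ Real.sqrt (2^n) := by
    rw [Real.one_le_sqrt]; exact one_le_pow₀ (by norm_num)
  have hA : (vv α n * 4^(n+1))⁻¹ ≤ qq α ^ n := by
    refine le_trans ?_ hB
    exact le_mul_of_one_le_right (by positivity) hs1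
  calc _ = β⁻¹ * ((n+3) * (vv α n * 4^(n+1))⁻¹) +
        fh * ((n+3) * ((vv α n * 4^(n+1))⁻¹ * Real.sqrt (2^n))) := by field_simp
    _ ≤ β⁻¹ * ((n+3) * qq α ^ n) + fh * ((n+3) * qq α ^ n) := by gcongr
    _ = _ := by ring

lemma summ (α : ℝ) (hα2 : α < 3/2) : Summable (fun n : ℕ => ((n:ℝ) + 3) * qq α ^ n) := by
  have hq0 : 0 ≤ qq α := by unfold qq; positivity
  have hq1 : qq α < 1 := Real.rpow_lt_one_of_one_lt_of_neg (by norm_num) (by linarith)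
  have h1 := summable_pow_mul_geometric_of_norm_lt_one (R := ℝ) 1 (r := qq α)
    (by rwa [Real.norm_of_nonneg hq0])
  have h2 := (summable_geometric_of_lt_one hq0 hq1).mul_left 3
  refine (h1.add h2).congr fun n => ?_
  simp; ring

lemma D_mean (α : ℝ) (hα2 : α < 3/2) {β fh : ℝ} (hβ : 0 < β) (hf : 0 < fh) (N : ℕ) :
    av N (D α β fh N) ≤ (β⁻¹ + fh) * ∑' n : ℕ, ((n:ℝ) + 3) * qq α ^ n := by
  have hq0 : 0 ≤ qq α := by unfold qq; positivity
  have h : av N (D α β fh N) ≤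
      (β⁻¹ + fh) * ∑ n ∈ Finset.range N, ((n:ℝ) + 3) * qq α ^ n := by
    induction N with
    | zero => simp [av, D]
    | succ n ih =>
      rw [Finset.sum_range_succ, mul_add]
      linarith [D_step α hβ hf n, coef_le α hα2 hβ hf n]
  refine h.trans ?_
  apply mul_le_mul_of_nonneg_left _ (by positivity)
  exact (summ α hα2).sum_le_tsum _ (fun n _ => by positivity)

lemma fB_eq (α β fh : ℝ) (N : ℕ) : fB α β fh N = av N (fun ε =>
    (∑ σ, (totalSpin N σ)^2 / 4^N * w α β fh N ε σ) / ∑ σ, w α β fh N ε σ) := by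
  unfold fB bernoulliExp gibbs av
  rw [mul_left_comm, Finset.mul_sum]
  congr 1
  refine Finset.sum_congr rfl fun ε _ => ?_
  rw [mul_div_assoc', Finset.mul_sum]
  congr 1
  refine Finset.sum_congr rfl fun σ _ => ?_
  have : (2:ℝ)^(2*N) = 4^N := by rw [pow_mul]; norm_num
  rw [this]
  unfold w
  ring

lemma fB_ge (α : ℝ) {β fh : ℝ} (hβ : 0 < β) (hf : 0 < fh) (N : ℕ) :
    1 - av N (D α β fh N) ≤ fB α β fh N := by
  rw [fB_eq]
  have h1 : (1:ℝ) = av N (fun _ => 1) := by simp [av]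
  rw [h1]
  unfold av
  rw [← mul_sub, ← Finset.sum_sub_distrib]
  gcongr with ε
  have hZ : 0 < ∑ σ, w α β fh N ε σ := Finset.sum_pos (fun _ _ => w_pos ..) Finset.univ_nonempty
  rw [le_div_iff₀ hZ]
  have := main α hβ hf N (fun _ => 1) ⟨fun _ => one_pos, fun _ _ => by norm_num⟩ ε
  simp only [mul_one, mul_sub, Finset.sum_sub_distrib] at this
  simp only [mul_comm ((totalSpin N _)^2 / 4^N)]
  linarith

lemma fB_le (α β fh : ℝ) (N : ℕ) : fB α β fh N ≤ 1 := by
  rw [fB_eq]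
  have h1 : (1:ℝ) = av N (fun _ => 1) := by simp [av]
  rw [h1]
  unfold av
  gcongr with ε
  have hZ : 0 < ∑ σ, w α β fh N ε σ := Finset.sum_pos (fun _ _ => w_pos ..) Finset.univ_nonempty
  rw [div_le_one hZ]
  refine Finset.sum_le_sum fun σ _ => ?_
  have hS : |totalSpin N σ| ≤ 2^N := by
    unfold totalSpin
    refine (Finset.abs_sum_le_sum_abs _ _).trans ?_
    simp [abs_spin]
  have : (totalSpin N σ)^2 / 4^N ≤ 1 := by
    rw [div_le_one (by positivity)]
    have h4 : (4:ℝ)^N = (2^N)^2 := by rw [← pow_mul, mul_comm, pow_mul]; norm_num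
    rw [h4]
    exact sq_le_sq' (by linarith [(abs_le.mp hS).1]) (abs_le.mp hS).2
  exact mul_le_of_le_one_left (w_pos ..).le this

end RF

/-- Corollary (bernoulli random fields): for `1 < α < 3/2` there is long-range order
(`m² > 0`) at sufficiently low temperature and sufficiently small nonzero field strength. -/
theorem rfim_dyson_lro_exists_bernoulli (α : ℝ) (hα1 : 1 < α) (hα2 : α < 3/2) :
    ∃ h0 > (0:ℝ), ∃ β0 > (0:ℝ), ∀ fh : ℝ, 0 < fh → fh ≤ h0 → ∀ β : ℝ, β0 ≤ β →
      0 < Filter.liminf (fun N => fB α β fh N) Filter.atTop := by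
  obtain ⟨A, hA⟩ : ∃ A, A = ∑' n : ℕ, ((n:ℝ) + 3) * RF.qq α ^ n := ⟨_, rfl⟩
  have hq0 : 0 ≤ RF.qq α := by unfold RF.qq; positivity
  have hA0 : 0 < A := by
    have := (RF.summ α hα2).sum_le_tsum (Finset.range 1) (fun n _ => by positivity)
    rw [← hA] at this
    simp at this
    linarith
  refine ⟨1/(4*A), by positivity, 4*A, by positivity, fun fh hf hfh β hβ => ?_⟩
  have hβ0 : 0 < β := by linarith
  have key : ∀ N, (1/2:ℝ) ≤ fB α β fh N := by
    intro N
    have h1 := RF.fB_ge α hβ0 hf N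
    have h2 := RF.D_mean α hα2 hβ0 hf N
    rw [← hA] at h2
    have h3 : β⁻¹ * A ≤ 1/4 := by
      rw [inv_mul_le_iff₀ hβ0]; linarith
    have h4 : fh * A ≤ 1/4 := by
      rw [le_div_iff₀ (by positivity)] at hfh; linarith
    linarith
  have hl : (1/2:ℝ) ≤ Filter.liminf (fun N => fB α β fh N) Filter.atTop := by
    apply Filter.le_liminf_of_le
    · exact Filter.IsBoundedUnder.isCoboundedUnder_ge
        (Filter.isBoundedUnder_of ⟨1, fun N => RF.fB_le α β fh N⟩)
    · exact Filter.Eventually.of_forall key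
  linarith

end
end

section
/- Fix α > 1, β > 0, h > 0, c > 0, d ≥ 0, and N ≥ 1, and let the random fields be i.i.d. standard Gaussian. Then the quenched average of the squared total magnetization satisfies the recurrence inequality f_N ≥ f_{N−1} − (1/(β b_N))·( 1/(c β^{d−1}) + log(1 + (c β^d b_N)^{1/2}) + E[ max_{1≤k≤r_N} log( Z_{k,1}(h₁)/Z_{k,2}(h₂) ) ] ). -/
open MeasureTheory ProbabilityTheory Filter
open scoped Classical

noncomputable section

lemma aux_jensen {ι : Type*} [Fintype ι] [Nonempty ι] (p T : ι → ℝ) (hp : ∀ i, 0 < p i) :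
    (∑ i, T i * p i) / (∑ i, p i) ≤
      Real.log (∑ i, p i * Real.exp (T i)) - Real.log (∑ i, p i) := by
  have hP : 0 < ∑ i, p i := Finset.sum_pos (fun i _ => hp i) Finset.univ_nonempty
  set m := (∑ i, T i * p i) / (∑ i, p i) with hm
  have hmP : m * ∑ i, p i = ∑ i, T i * p i := by rw [hm]; field_simp
  have h1 : Real.exp m * ∑ i, p i ≤ ∑ i, p i * Real.exp (T i) := by
    have h2 : ∀ i, p i * (Real.exp m * (1 + T i - m)) ≤ p i * Real.exp (T i) := by
      intro i
      apply mul_le_mul_of_nonneg_left _ (hp i).le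
      have h3 := Real.add_one_le_exp (T i - m)
      have h4 : Real.exp (T i) = Real.exp m * Real.exp (T i - m) := by
        rw [← Real.exp_add]; congr 1; ring
      rw [h4]
      apply mul_le_mul_of_nonneg_left _ (Real.exp_pos m).le
      linarith
    have h5 := Finset.sum_le_sum (s := Finset.univ) (fun i _ => h2 i)
    have h6 : ∑ i, p i * (Real.exp m * (1 + T i - m)) = Real.exp m * ∑ i, p i := by
      have : ∀ i, p i * (Real.exp m * (1 + T i - m))
          = Real.exp m * p i + Real.exp m * (T i * p i) - Real.exp m * (m * p i) := by
        intro i; ring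
      simp only [this, Finset.sum_add_distrib, Finset.sum_sub_distrib, ← Finset.mul_sum]
      rw [hmP]; ring
    linarith
  have h7 := Real.log_le_log (by positivity) h1
  rw [Real.log_mul (Real.exp_pos m).ne' hP.ne', Real.log_exp] at h7
  linarith

lemma aux_core {ι : Type*} [Fintype ι] [Nonempty ι] (p q S : ι → ℝ) (hp : ∀ i, 0 < p i)
    (hq : ∀ i, 0 < q i) (v w2 G : ℝ) (hv : 0 ≤ v) (r : ℕ) (hr : 1 ≤ r)
    (B : ℕ → ℝ → Prop) (cover : ∀ i, ∃ k ∈ Finset.Icc 1 r, B k (S i))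
    (diam : ∀ k a b, B k a → B k b → (a - b)^2 ≤ w2)
    (hG : ∀ k ∈ Finset.Icc 1 r,
      (∑ i, if B k (S i) then p i * Real.exp (2 * v * S i ^ 2) else 0) ≤
      Real.exp G * (∑ i, if B k (S i) then q i * Real.exp (2 * v * S i ^ 2) else 0)) :
    -(v * w2) - Real.log r - G + 4 * v * ((∑ i, S i ^ 2 * p i) / ∑ i, p i)
      + Real.log (∑ i, p i) - Real.log (∑ i, q i) ≤
    v * ((∑ z : ι × ι, (S z.1 + S z.2)^2 * (p z.1 * q z.2 * Real.exp (v * (S z.1 + S z.2)^2))) /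
      ∑ z : ι × ι, (p z.1 * q z.2 * Real.exp (v * (S z.1 + S z.2)^2))) := by
  have hP : 0 < ∑ i, p i := Finset.sum_pos (fun i _ => hp i) Finset.univ_nonempty
  have hQ : 0 < ∑ i, q i := Finset.sum_pos (fun i _ => hq i) Finset.univ_nonempty
  have hr0 : (0:ℝ) < r := by exact_mod_cast hr
  -- Jensen for the small system
  have J1 := aux_jensen p (fun i => 2 * v * S i ^ 2) hp
  have J1' : (∑ i, 2 * v * S i ^ 2 * p i) = 2 * v * ∑ i, S i ^ 2 * p i := by
    rw [Finset.mul_sum]; exact Finset.sum_congr rfl fun i _ => by ring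
  rw [J1', mul_div_assoc] at J1
  -- Jensen for the large system
  have hE : ∀ z : ι × ι, 0 < p z.1 * q z.2 * Real.exp (v * (S z.1 + S z.2)^2) :=
    fun z => mul_pos (mul_pos (hp _) (hq _)) (Real.exp_pos _)
  have J2 := aux_jensen (fun z : ι × ι => p z.1 * q z.2 * Real.exp (v * (S z.1 + S z.2)^2))
    (fun z => -(v * (S z.1 + S z.2)^2)) hE
  have J2' : (∑ z : ι × ι, -(v * (S z.1 + S z.2)^2) *
      (p z.1 * q z.2 * Real.exp (v * (S z.1 + S z.2)^2)))
      = - v * ∑ z : ι × ι, (S z.1 + S z.2)^2 *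
      (p z.1 * q z.2 * Real.exp (v * (S z.1 + S z.2)^2)) := by
    rw [Finset.mul_sum]; exact Finset.sum_congr rfl fun i _ => by ring
  have J2'' : (∑ z : ι × ι, (p z.1 * q z.2 * Real.exp (v * (S z.1 + S z.2)^2)) *
      Real.exp (-(v * (S z.1 + S z.2)^2))) = (∑ i, p i) * ∑ i, q i := by
    rw [Finset.sum_mul_sum, Fintype.sum_prod_type]
    refine Finset.sum_congr rfl fun i _ => Finset.sum_congr rfl fun j _ => ?_
    rw [mul_assoc, ← Real.exp_add]; simp
  rw [J2', J2'', mul_div_assoc, Real.log_mul hP.ne' hQ.ne'] at J2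
  set Z := ∑ z : ι × ι, (p z.1 * q z.2 * Real.exp (v * (S z.1 + S z.2)^2)) with hZ
  set A := ∑ i, p i * Real.exp (2 * v * S i ^ 2) with hA
  have hApos : 0 < A :=
    Finset.sum_pos (fun i _ => mul_pos (hp i) (Real.exp_pos _)) Finset.univ_nonempty
  -- main bound
  choose κ hκ hB using cover
  set x : ι → ℝ := fun i => p i * Real.exp (2 * v * S i ^ 2) with hx
  set y : ι → ℝ := fun i => q i * Real.exp (2 * v * S i ^ 2) with hy
  have hxp : ∀ i, 0 < x i := fun i => mul_pos (hp i) (Real.exp_pos _)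
  have hyp : ∀ i, 0 < y i := fun i => mul_pos (hq i) (Real.exp_pos _)
  set X : ℕ → ℝ := fun k => ∑ i, if κ i = k then x i else 0 with hX
  set Y : ℕ → ℝ := fun k => ∑ j, if B k (S j) then y j else 0 with hY
  have hXnn : ∀ k, 0 ≤ X k := fun k => Finset.sum_nonneg fun i _ => by
    split_ifs; exacts [(hxp i).le, le_rfl]
  have hAX : A = ∑ k ∈ Finset.Icc 1 r, X k := by
    rw [hX, Finset.sum_comm]
    refine Finset.sum_congr rfl fun i _ => ?_
    rw [Finset.sum_ite_eq, if_pos (hκ i)]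
  have hXY : ∀ k ∈ Finset.Icc 1 r, X k ≤ Real.exp G * Y k := by
    intro k hk
    refine le_trans (Finset.sum_le_sum fun i _ => ?_) (hG k hk)
    by_cases h : κ i = k
    · have := hB i
      rw [h] at this
      rw [if_pos h, if_pos this]
    · rw [if_neg h]
      split_ifs; exacts [(hxp i).le, le_rfl]
  have hCS : A ^ 2 ≤ r * ∑ k ∈ Finset.Icc 1 r, X k ^ 2 := by
    have := sq_sum_le_card_mul_sum_sq (s := Finset.Icc 1 r) (f := X)
    rw [hAX]; simpa using this
  have hD : ∑ k ∈ Finset.Icc 1 r, X k * Y k ≤ Real.exp (v * w2) * Z := by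
    have e1 : ∑ k ∈ Finset.Icc 1 r, X k * Y k =
        ∑ i, ∑ j, if B (κ i) (S j) then x i * y j else 0 := by
      have : ∀ k, X k * Y k = ∑ i, if κ i = k then x i * Y k else 0 := by
        intro k
        rw [hX, Finset.sum_mul]
        exact Finset.sum_congr rfl fun i _ => by rw [ite_mul, zero_mul]
      simp only [this]
      rw [Finset.sum_comm]
      refine Finset.sum_congr rfl fun i _ => ?_
      rw [Finset.sum_ite_eq, if_pos (hκ i), hY, Finset.mul_sum]
      exact Finset.sum_congr rfl fun i _ => by rw [mul_ite, mul_zero]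
    rw [e1, hZ, Finset.mul_sum, Fintype.sum_prod_type]
    refine Finset.sum_le_sum fun i _ => Finset.sum_le_sum fun j _ => ?_
    have hnn : 0 < p i * q j := mul_pos (hp i) (hq j)
    split_ifs with h
    · have hd := diam _ _ _ (hB i) h
      have hd' := mul_le_mul_of_nonneg_left hd hv
      have e2 : x i * y j = p i * q j * Real.exp (2 * v * S i ^ 2 + 2 * v * S j ^ 2) := by
        rw [Real.exp_add]; simp only [hx, hy]; ring
      have e3 : Real.exp (v * w2) * (p i * q j * Real.exp (v * (S i + S j) ^ 2))
          = p i * q j * Real.exp (v * w2 + v * (S i + S j) ^ 2) := by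
        rw [Real.exp_add]; ring
      rw [e2]
      refine le_trans (mul_le_mul_of_nonneg_left (Real.exp_le_exp.2 ?_) hnn.le) e3.ge
      nlinarith
    · positivity
  have hXX : ∑ k ∈ Finset.Icc 1 r, X k ^ 2 ≤ Real.exp G * ∑ k ∈ Finset.Icc 1 r, X k * Y k := by
    rw [Finset.mul_sum]
    refine Finset.sum_le_sum fun k hk => ?_
    nlinarith [mul_le_mul_of_nonneg_left (hXY k hk) (hXnn k)]
  have hmain : A ^ 2 ≤ r * (Real.exp G * (Real.exp (v * w2) * Z)) := by
    refine hCS.trans (mul_le_mul_of_nonneg_left (hXX.trans ?_) hr0.le)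
    exact mul_le_mul_of_nonneg_left hD (Real.exp_pos _).le
  have hZpos : 0 < Z := Finset.sum_pos (fun z _ => hE z) Finset.univ_nonempty
  have hl := Real.log_le_log (by positivity) hmain
  rw [Real.log_pow, Real.log_mul hr0.ne' (by positivity), Real.log_mul (by positivity)
    (by positivity), Real.log_mul (by positivity) hZpos.ne', Real.log_exp, Real.log_exp] at hl
  push_cast at hl
  linarith

lemma aux_logsumexp_integrable {Ω ι : Type*} [MeasurableSpace Ω] (μ : Measure Ω)
    [IsProbabilityMeasure μ] (A : Finset ι) (u : ι → Ω → ℝ) (hm : ∀ i, Measurable (u i))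
    (hu : ∀ i, Integrable (u i) μ) :
    Integrable (fun ω => Real.log (∑ i ∈ A, Real.exp (u i ω))) μ := by
  rcases A.eq_empty_or_nonempty with rfl | ⟨i0, hi0⟩
  · simp
  have hmeas : Measurable (fun ω => Real.log (∑ i ∈ A, Real.exp (u i ω))) := by
    apply Real.measurable_log.comp
    exact Finset.measurable_sum _ fun i _ => Real.measurable_exp.comp (hm i)
  have hb : Integrable (fun ω => (∑ i ∈ A, |u i ω|) + Real.log A.card) μ :=
    (integrable_finsetSum _ fun i _ => (hu i).abs).add (integrable_const _)
  refine hb.mono' hmeas.aestronglyMeasurable (Filter.Eventually.of_forall fun ω => ?_)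
  have hc : (0:ℝ) < A.card := by exact_mod_cast Finset.card_pos.2 ⟨i0, hi0⟩
  have hc1 : (1:ℝ) ≤ A.card := by exact_mod_cast Finset.card_pos.2 ⟨i0, hi0⟩
  have hlc := Real.log_nonneg hc1
  have hle : ∀ i ∈ A, |u i ω| ≤ ∑ i ∈ A, |u i ω| := fun i hi =>
    Finset.single_le_sum (f := fun i => |u i ω|) (fun _ _ => abs_nonneg _) hi
  have hup : ∑ i ∈ A, Real.exp (u i ω) ≤ A.card * Real.exp (∑ i ∈ A, |u i ω|) := by
    rw [← nsmul_eq_mul]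
    exact Finset.sum_le_card_nsmul _ _ _ fun i hi =>
      Real.exp_le_exp.2 ((le_abs_self _).trans (hle i hi))
  have hlo : Real.exp (u i0 ω) ≤ ∑ i ∈ A, Real.exp (u i ω) :=
    Finset.single_le_sum (f := fun i => Real.exp (u i ω)) (fun _ _ => (Real.exp_pos _).le) hi0
  have h1 := Real.log_le_log (Real.exp_pos _) hlo
  have h2 := Real.log_le_log (lt_of_lt_of_le (Real.exp_pos _) hlo) hup
  rw [Real.log_exp] at h1
  rw [Real.log_mul hc.ne' (Real.exp_pos _).ne', Real.log_exp] at h2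
  rw [Real.norm_eq_abs, abs_le]
  have := hle i0 hi0
  have := neg_abs_le (u i0 ω)
  constructor <;> linarith

instance aux_prob (n : ℕ) : IsProbabilityMeasure (gaussianFields n) := by
  unfold gaussianFields; infer_instance

lemma aux_mp (m n : ℕ) (f : Fin m → Fin n) (hf : Function.Injective f) :
    MeasurePreserving (fun (η : Fin n → ℝ) i => η (f i)) (gaussianFields n) (gaussianFields m) := by
  have hmeas : Measurable (fun (η : Fin n → ℝ) i => η (f i)) := by fun_prop
  refine ⟨hmeas, ?_⟩
  unfold gaussianFields
  symm
  refine Measure.pi_eq fun s hs => ?_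
  rw [Measure.map_apply hmeas (MeasurableSet.univ_pi hs)]
  have : (fun (η : Fin n → ℝ) i => η (f i)) ⁻¹' Set.univ.pi s =
      Set.univ.pi (Function.extend f s (fun _ => Set.univ)) := by
    ext η
    simp only [Set.mem_preimage, Set.mem_pi, Set.mem_univ, true_imp_iff]
    constructor
    · intro h i
      by_cases hi : ∃ j, f j = i
      · obtain ⟨j, rfl⟩ := hi
        rw [hf.extend_apply]; exact h j
      · rw [Function.extend_apply' _ _ _ hi]; trivial
    · intro h j
      have := h (f j)
      rwa [hf.extend_apply] at this
  rw [this, Measure.pi_pi, ← Finset.prod_subset (Finset.subset_univ (Finset.univ.image f)),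
    Finset.prod_image (fun a _ b _ h => hf h)]
  · exact Finset.prod_congr rfl fun i _ => by rw [hf.extend_apply]
  · intro i _ hi
    have hi' : ¬ ∃ j, f j = i := by simpa using hi
    rw [Function.extend_apply' _ _ _ hi', measure_univ]

lemma aux_eval_integrable (n : ℕ) (i : Fin n) :
    Integrable (fun η : Fin n → ℝ => η i) (gaussianFields n) := by
  have h1 : MeasurePreserving (Function.eval i) (gaussianFields n) (gaussianReal 0 1) := by
    unfold gaussianFields
    exact measurePreserving_eval (fun _ => gaussianReal 0 1) i
  have h2 : Integrable (id : ℝ → ℝ) (gaussianReal 0 1) :=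
    (memLp_id_gaussianReal 1).integrable le_rfl
  exact h1.integrable_comp_of_integrable h2

lemma aux_HRF_measurable (α fh : ℝ) (n : ℕ) (σ : Fin (2^n) → Bool) :
    Measurable (fun η => dysonHRF α fh n η σ) := by
  unfold dysonHRF; fun_prop

lemma aux_HRF_integrable (α fh : ℝ) (n : ℕ) (σ : Fin (2^n) → Bool) :
    Integrable (fun η => dysonHRF α fh n η σ) (gaussianFields (2^n)) := by
  unfold dysonHRF
  exact (integrable_const _).sub ((integrable_finsetSum _ fun i _ =>
    (aux_eval_integrable _ i).mul_const _).const_mul _)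

lemma aux_gibbs_integrable (α β fh : ℝ) (n : ℕ) (F : (Fin (2^n) → Bool) → ℝ) :
    Integrable (fun η => gibbs α β fh n η F) (gaussianFields (2^n)) := by
  have hm := fun σ => aux_HRF_measurable α fh n σ
  have hmeas : Measurable (fun η => gibbs α β fh n η F) := by
    unfold gibbs
    fun_prop
  refine (integrable_const (∑ σ, |F σ|)).mono' hmeas.aestronglyMeasurable
    (Filter.Eventually.of_forall fun η => ?_)
  unfold gibbs
  have hpos : 0 < ∑ σ, Real.exp (-β * dysonHRF α fh n η σ) :=
    Finset.sum_pos (fun _ _ => Real.exp_pos _) Finset.univ_nonempty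
  rw [Real.norm_eq_abs, abs_div, abs_of_pos hpos, div_le_iff₀ hpos, Finset.sum_mul]
  refine (Finset.abs_sum_le_sum_abs _ _).trans (Finset.sum_le_sum fun σ _ => ?_)
  rw [abs_mul, abs_of_pos (Real.exp_pos _)]
  exact mul_le_mul_of_nonneg_left (Finset.single_le_sum
    (f := fun σ => Real.exp (-β * dysonHRF α fh n η σ)) (fun _ _ => (Real.exp_pos _).le)
    (Finset.mem_univ σ)) (abs_nonneg _)

lemma aux_L_integrable (α β fh : ℝ) (n : ℕ) :
    Integrable (fun η => Real.log (∑ σ, Real.exp (-β * dysonHRF α fh n η σ)))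
      (gaussianFields (2^n)) :=
  aux_logsumexp_integrable _ Finset.univ (fun σ η => -β * dysonHRF α fh n η σ)
    (fun σ => (aux_HRF_measurable α fh n σ).const_mul _)
    (fun σ => (aux_HRF_integrable α fh n σ).const_mul _)

lemma aux_Zres_integrable (α β fh : ℝ) (n r k : ℕ) :
    Integrable (fun η => Real.log (Zres α β fh (n+1) r k η)) (gaussianFields (2^n)) := by
  have := aux_logsumexp_integrable (gaussianFields (2^n))
    (Finset.univ.filter fun σ : Fin (2^n) → Bool => inBlock (n+1) r k (totalSpin n σ))
    (fun σ η => -β * dysonHRF α fh n η σ +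
      2 * β * bcoef α (n+1) * ((2:ℝ)^(2*(n+1)))⁻¹ * (totalSpin n σ)^2)
    (fun σ => ((aux_HRF_measurable α fh n σ).const_mul _).add_const _)
    (fun σ => ((aux_HRF_integrable α fh n σ).const_mul _).add (integrable_const _))
  simp only [Finset.sum_filter] at this
  exact this

def auxl (n : ℕ) (i : Fin (2^n)) : Fin (2^(n+1)) :=
  ⟨i.1, by have := i.2; rw [pow_succ]; omega⟩

def auxr (n : ℕ) (i : Fin (2^n)) : Fin (2^(n+1)) :=
  ⟨2^n + i.1, by have := i.2; rw [pow_succ]; omega⟩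

lemma auxl_inj (n : ℕ) : Function.Injective (auxl n) := by
  intro a b h; simp only [auxl, Fin.mk.injEq] at h; exact Fin.ext h

lemma auxr_inj (n : ℕ) : Function.Injective (auxr n) := by
  intro a b h; simp only [auxr, Fin.mk.injEq] at h; exact Fin.ext (by omega)

def auxe (n : ℕ) : Fin (2^n) ⊕ Fin (2^n) ≃ Fin (2^(n+1)) :=
  finSumFinEquiv.trans (finCongr (by rw [pow_succ]; omega))

lemma auxe_inl (n : ℕ) (i : Fin (2^n)) : auxe n (Sum.inl i) = auxl n i := by
  ext; simp [auxe, auxl]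

lemma auxe_inr (n : ℕ) (i : Fin (2^n)) : auxe n (Sum.inr i) = auxr n i := by
  ext; simp [auxe, auxr, add_comm]

lemma aux_sum_split (n : ℕ) (f : Fin (2^(n+1)) → ℝ) :
    ∑ i, f i = ∑ i, f (auxl n i) + ∑ i, f (auxr n i) := by
  rw [← (auxe n).sum_comp, Fintype.sum_sum_type]
  simp only [auxe_inl, auxe_inr]

def auxcfg (n : ℕ) : (Fin (2^(n+1)) → Bool) ≃ (Fin (2^n) → Bool) × (Fin (2^n) → Bool) :=
  ((auxe n).symm.arrowCongr (Equiv.refl Bool)).trans (Equiv.sumArrowEquivProdArrow _ _ _)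

lemma auxcfg_apply (n : ℕ) (σ : Fin (2^(n+1)) → Bool) :
    auxcfg n σ = (fun i => σ (auxl n i), fun i => σ (auxr n i)) := by
  ext i <;> simp [auxcfg, Equiv.sumArrowEquivProdArrow, ← auxe_inl, ← auxe_inr]

lemma aux_half1 (n : ℕ) (η : Fin (2^(n+1)) → ℝ) :
    half1 (n+1) η = fun i => η (auxl n i) := rfl

lemma aux_half2 (n : ℕ) (η : Fin (2^(n+1)) → ℝ) :
    half2 (n+1) η = fun i => η (auxr n i) := by
  funext i
  have hi : i.1 < 2^n := i.2
  have h : 2^(n+1-1) + i.1 < 2^(n+1) := by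
    simp only [Nat.add_sub_cancel]; rw [pow_succ]; omega
  unfold half2
  rw [dif_pos h]
  rfl

lemma aux_tot (n : ℕ) (σ : Fin (2^(n+1)) → Bool) :
    totalSpin (n+1) σ = totalSpin n (fun i => σ (auxl n i)) + totalSpin n (fun i => σ (auxr n i)) :=
  aux_sum_split n fun i => spin (σ i)

lemma aux_bcoef (α : ℝ) (n : ℕ) :
    (2:ℝ) ^ (-(α * ((n:ℝ)+1))) = bcoef α (n+1) * ((2:ℝ)^(2*(n+1)))⁻¹ := by
  unfold bcoef
  rw [← Real.rpow_natCast, ← Real.rpow_neg (by norm_num), ← Real.rpow_add (by norm_num)]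
  congr 1; push_cast; ring

lemma aux_weight (α β fh : ℝ) (n : ℕ) (η : Fin (2^(n+1)) → ℝ) (σ : Fin (2^(n+1)) → Bool) :
    Real.exp (-β * dysonHRF α fh (n+1) η σ) =
      Real.exp (-β * dysonHRF α fh n (half1 (n+1) η) (auxcfg n σ).1) *
      Real.exp (-β * dysonHRF α fh n (half2 (n+1) η) (auxcfg n σ).2) *
      Real.exp (β * bcoef α (n+1) * ((2:ℝ)^(2*(n+1)))⁻¹ *
        (totalSpin n (auxcfg n σ).1 + totalSpin n (auxcfg n σ).2)^2) := by
  rw [← Real.exp_add, ← Real.exp_add, auxcfg_apply, aux_half1, aux_half2]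
  congr 1
  have h1 : dysonH α (n+1) σ = dysonH α n (fun i => σ (auxl n i))
      + dysonH α n (fun i => σ (auxr n i))
      - (2:ℝ) ^ (-(α * ((n:ℝ)+1))) * (totalSpin (n+1) σ)^2 := by
    rw [sq, totalSpin, Finset.sum_mul_sum]
    rfl
  unfold dysonHRF
  rw [h1, aux_bcoef, aux_tot, aux_sum_split n (fun i => η i * spin (σ i))]
  ring

lemma aux_tot_abs (n : ℕ) (σ : Fin (2^n) → Bool) : |totalSpin n σ| ≤ 2^n := by
  unfold totalSpin
  refine (Finset.abs_sum_le_sum_abs _ _).trans ?_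
  have : ∀ i, |spin (σ i)| = 1 := by
    intro i; unfold spin; split_ifs <;> simp
  simp [this]

lemma aux_cover (n r : ℕ) (hr : 1 ≤ r) (x : ℝ) (hx : |x| ≤ 2^n) :
    ∃ k ∈ Finset.Icc 1 r, inBlock (n+1) r k x := by
  have hr0 : (0:ℝ) < r := by exact_mod_cast hr
  rw [abs_le] at hx
  set w : ℝ := (2:ℝ)^(n+1) / r with hw
  have hwp : 0 < w := by positivity
  have hrw : r * w = 2 * 2^n := by rw [hw, pow_succ]; field_simp
  set t := (x + 2^n) / w with ht
  have htw : t * w = x + 2^n := by rw [ht]; field_simp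
  have ht0 : 0 ≤ t := div_nonneg (by linarith) hwp.le
  have htr : t ≤ r := by rw [ht, div_le_iff₀ hwp]; linarith
  unfold inBlock
  simp only [Nat.add_sub_cancel]
  rw [← hw]
  rcases ht0.eq_or_lt with h0 | h0
  · refine ⟨1, by simp [hr], ?_, ?_⟩
    · push_cast; linarith
    · push_cast; rw [← h0] at htw; linarith
  · refine ⟨⌈t⌉₊, ?_, ?_, ?_⟩
    · simp only [Finset.mem_Icc]
      exact ⟨Nat.one_le_iff_ne_zero.2 (Nat.ceil_pos.2 h0).ne', Nat.ceil_le.2 htr⟩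
    · have := Nat.ceil_lt_add_one ht0
      nlinarith
    · have := Nat.le_ceil t
      nlinarith

lemma aux_diam (n r k : ℕ) (a b : ℝ) (ha : inBlock (n+1) r k a) (hb : inBlock (n+1) r k b) :
    (a - b)^2 ≤ ((2:ℝ)^(n+1) / r)^2 := by
  unfold inBlock at ha hb
  apply sq_le_sq'
  · linarith [ha.1, hb.2]
  · linarith [ha.2, hb.1]

lemma aux_Zpos (α β fh : ℝ) (n r k : ℕ)
    (h : ∃ σ : Fin (2^n) → Bool, inBlock (n+1) r k (totalSpin n σ)) (η : Fin (2^n) → ℝ) :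
    0 < Zres α β fh (n+1) r k η := by
  obtain ⟨σ, hσ⟩ := h
  unfold Zres
  refine Finset.sum_pos' (fun τ _ => ?_) ⟨σ, Finset.mem_univ _, ?_⟩
  · split_ifs; exacts [(Real.exp_pos _).le, le_rfl]
  · have : inBlock (n+1) r k (totalSpin (n+1-1) σ) := hσ
    rw [if_pos this]; exact Real.exp_pos _

lemma aux_Zzero (α β fh : ℝ) (n r k : ℕ)
    (h : ¬ ∃ σ : Fin (2^n) → Bool, inBlock (n+1) r k (totalSpin n σ)) (η : Fin (2^n) → ℝ) :
    Zres α β fh (n+1) r k η = 0 := by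
  push Not at h
  unfold Zres
  exact Finset.sum_eq_zero fun σ _ => if_neg (h σ)

lemma aux_gk (α β fh : ℝ) (n r k : ℕ) (η : Fin (2^(n+1)) → ℝ) :
    gk α β fh (n+1) r k η = Real.log (Zres α β fh (n+1) r k (half1 (n+1) η))
      - Real.log (Zres α β fh (n+1) r k (half2 (n+1) η)) := by
  unfold gk
  by_cases h : ∃ σ : Fin (2^n) → Bool, inBlock (n+1) r k (totalSpin n σ)
  · exact Real.log_div (aux_Zpos α β fh n r k h _).ne' (aux_Zpos α β fh n r k h _).ne'
  · have := aux_Zzero α β fh n r k h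
    rw [show Zres α β fh (n+1) r k (half1 (n+1) η) = 0 from this _,
      show Zres α β fh (n+1) r k (half2 (n+1) η) = 0 from this _]
    simp

lemma aux_mp1 (n : ℕ) : MeasurePreserving (fun η => (half1 (n+1) η : Fin (2^n) → ℝ))
    (gaussianFields (2^(n+1))) (gaussianFields (2^n)) :=
  aux_mp _ _ (auxl n) (auxl_inj n)

lemma aux_mp2 (n : ℕ) : MeasurePreserving (fun η => (half2 (n+1) η : Fin (2^n) → ℝ))
    (gaussianFields (2^(n+1))) (gaussianFields (2^n)) := by
  have := aux_mp _ _ (auxr n) (auxr_inj n)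
  have e : (fun η => (half2 (n+1) η : Fin (2^n) → ℝ)) = fun η i => η (auxr n i) :=
    funext fun η => aux_half2 n η
  rw [e]; exact this

lemma aux_gk_integrable (α β fh : ℝ) (n r k : ℕ) :
    Integrable (fun η => gk α β fh (n+1) r k η) (gaussianFields (2^(n+1))) := by
  simp only [aux_gk]
  exact ((aux_mp1 n).integrable_comp_of_integrable (aux_Zres_integrable α β fh n r k)).sub
    ((aux_mp2 n).integrable_comp_of_integrable (aux_Zres_integrable α β fh n r k))

lemma aux_max_integrable (α β fh : ℝ) (n r : ℕ) (hr : 1 ≤ r) :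
    Integrable (fun η => maxgk α β fh (n+1) r hr η) (gaussianFields (2^(n+1))) := by
  have h : (fun η => maxgk α β fh (n+1) r hr η) =
      (Finset.Icc 1 r).sup' (Finset.nonempty_Icc.mpr hr)
        (fun k => fun η => gk α β fh (n+1) r k η) := by
    funext η
    rw [Finset.sup'_apply]; rfl
  rw [h]
  exact Finset.sup'_induction (p := fun f => Integrable f (gaussianFields (2^(n+1)))) _ _
    (fun f hf g hg => hf.sup hg) (fun k _ => aux_gk_integrable α β fh n r k)

lemma aux_pointwise (α β fh : ℝ) (hβ : 0 < β) (n r : ℕ) (hr : 1 ≤ r) (η : Fin (2^(n+1)) → ℝ)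
    (v : ℝ) (hv : v = β * bcoef α (n+1) * ((2:ℝ)^(2*(n+1)))⁻¹) :
    -(v * ((2:ℝ)^(n+1) / r)^2) - Real.log r - maxgk α β fh (n+1) r hr η
      + 4 * v * gibbs α β fh n (half1 (n+1) η) (fun σ => (totalSpin n σ)^2)
      + Real.log (∑ σ, Real.exp (-β * dysonHRF α fh n (half1 (n+1) η) σ))
      - Real.log (∑ σ, Real.exp (-β * dysonHRF α fh n (half2 (n+1) η) σ))
    ≤ v * gibbs α β fh (n+1) η (fun σ => (totalSpin (n+1) σ)^2) := by
  have hb : 0 < bcoef α (n+1) := Real.rpow_pos_of_pos (by norm_num) _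
  have hv0 : 0 ≤ v := by rw [hv]; positivity
  have key := aux_core (fun σ => Real.exp (-β * dysonHRF α fh n (half1 (n+1) η) σ))
    (fun σ => Real.exp (-β * dysonHRF α fh n (half2 (n+1) η) σ)) (totalSpin n)
    (fun _ => Real.exp_pos _) (fun _ => Real.exp_pos _) v (((2:ℝ)^(n+1) / r)^2)
    (maxgk α β fh (n+1) r hr η) hv0 r hr (inBlock (n+1) r)
    (fun σ => aux_cover n r hr _ (aux_tot_abs n σ)) (aux_diam n r) ?_
  · refine key.trans (le_of_eq ?_)
    congr 1
    unfold gibbs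
    congr 1
    · rw [← (auxcfg n).sum_comp]
      refine Finset.sum_congr rfl fun σ _ => ?_
      rw [aux_weight, hv]
      simp only [aux_tot, auxcfg_apply]
    · rw [← (auxcfg n).sum_comp]
      refine Finset.sum_congr rfl fun σ _ => ?_
      rw [aux_weight, hv]
  · intro k hk
    have hZ : ∀ ζ : Fin (2^n) → ℝ, (∑ σ, if inBlock (n+1) r k (totalSpin n σ) then
        Real.exp (-β * dysonHRF α fh n ζ σ) * Real.exp (2 * v * totalSpin n σ ^ 2) else 0)
        = Zres α β fh (n+1) r k ζ := by
      intro ζ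
      unfold Zres
      refine Finset.sum_congr rfl fun σ _ => ?_
      rw [← Real.exp_add, hv]
      simp only [mul_assoc]
      rfl
    refine (hZ _).trans_le (le_trans ?_ (mul_le_mul_of_nonneg_left (hZ _).ge (Real.exp_pos _).le))
    by_cases h : ∃ σ : Fin (2^n) → Bool, inBlock (n+1) r k (totalSpin n σ)
    · have p1 := aux_Zpos α β fh n r k h (half1 (n+1) η)
      have p2 := aux_Zpos α β fh n r k h (half2 (n+1) η)
      have hg : gk α β fh (n+1) r k η ≤ maxgk α β fh (n+1) r hr η :=
        Finset.le_sup' (fun k => gk α β fh (n+1) r k η) hk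
      rw [← div_le_iff₀ p2, ← Real.exp_log (div_pos p1 p2)]
      exact Real.exp_le_exp.2 hg
    · have := aux_Zzero α β fh n r k h
      refine (this _).trans_le ?_
      refine le_of_eq ?_
      symm
      exact mul_eq_zero_of_right _ (this _)

/-- Lemma 3 of the paper (gaussian random fields): the recurrence inequality for
`f_N = 2^{-2N} E[⟨S_{N,1}²⟩_N]`. -/
theorem rfim_dyson_recurrence_gaussian (α β fh c d : ℝ) (hα : 1 < α) (hβ : 0 < β)
    (hfh : 0 < fh) (hc : 0 < c) (hd : 0 ≤ d) (N : ℕ) (hN : 1 ≤ N) (r : ℕ) (hr : 1 ≤ r)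
    (hr1 : Real.sqrt (c * β^d * bcoef α N) < (r:ℝ))
    (hr2 : (r:ℝ) ≤ 1 + Real.sqrt (c * β^d * bcoef α N)) :
    fG α β fh N ≥ fG α β fh (N-1)
      - (1/(β * bcoef α N)) * (1/(c * β^(d-1))
        + Real.log (1 + Real.sqrt (c * β^d * bcoef α N))
        + (∫ η, maxgk α β fh N r hr η ∂ gaussianFields (2^N))) := by
  obtain ⟨n, rfl⟩ : ∃ n, N = n + 1 := ⟨N - 1, by omega⟩
  have hb : 0 < bcoef α (n+1) := Real.rpow_pos_of_pos (by norm_num) _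
  have hr0 : (0:ℝ) < r := by exact_mod_cast hr
  set v : ℝ := β * bcoef α (n+1) * ((2:ℝ)^(2*(n+1)))⁻¹ with hv
  set μ := gaussianFields (2^(n+1)) with hμ
  have pw := fun η => aux_pointwise α β fh hβ n r hr η v hv
  have iM := aux_max_integrable α β fh n r hr
  have iG1 := (aux_mp1 n).integrable_comp_of_integrable
    (aux_gibbs_integrable α β fh n (fun σ => (totalSpin n σ)^2))
  have iL1 := (aux_mp1 n).integrable_comp_of_integrable (aux_L_integrable α β fh n)
  have iL2 := (aux_mp2 n).integrable_comp_of_integrable (aux_L_integrable α β fh n)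
  have iG := aux_gibbs_integrable α β fh (n+1) (fun σ => (totalSpin (n+1) σ)^2)
  simp only [Function.comp_def] at iG1 iL1 iL2
  have eG1 := integral_map (aux_mp1 n).measurable.aemeasurable
    (f := fun ζ => gibbs α β fh n ζ (fun σ => (totalSpin n σ)^2))
    (by rw [(aux_mp1 n).map_eq]; exact (aux_gibbs_integrable α β fh n _).aestronglyMeasurable)
  have eL1 := integral_map (aux_mp1 n).measurable.aemeasurable
    (f := fun ζ => Real.log (∑ σ, Real.exp (-β * dysonHRF α fh n ζ σ)))
    (by rw [(aux_mp1 n).map_eq]; exact (aux_L_integrable α β fh n).aestronglyMeasurable)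
  have eL2 := integral_map (aux_mp2 n).measurable.aemeasurable
    (f := fun ζ => Real.log (∑ σ, Real.exp (-β * dysonHRF α fh n ζ σ)))
    (by rw [(aux_mp2 n).map_eq]; exact (aux_L_integrable α β fh n).aestronglyMeasurable)
  rw [(aux_mp1 n).map_eq] at eG1 eL1
  rw [(aux_mp2 n).map_eq] at eL2
  have i1 := (integrable_const (μ := μ) (-(v * ((2:ℝ)^(n+1) / r)^2) - Real.log r)).sub iM
  have i2 := i1.add (iG1.const_mul (4 * v))
  have i3 := i2.add iL1
  have i4 := i3.sub iL2
  have hint := integral_mono i4 (iG.const_mul v) pw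
  rw [integral_const_mul, integral_sub' i3 iL2, integral_add' i2 iL1,
    integral_add' i1 (iG1.const_mul (4*v)), integral_sub' (integrable_const _) iM,
    integral_const_mul, ← eG1, ← eL1, ← eL2] at hint
  simp only [integral_const, probReal_univ, smul_eq_mul, one_mul] at hint
  -- constants
  have hw : v * ((2:ℝ)^(n+1) / r)^2 = β * bcoef α (n+1) / (r:ℝ)^2 := by
    rw [hv, pow_mul' 2 2 (n+1)]; field_simp
  set s := Real.sqrt (c * β^d * bcoef α (n+1)) with hs
  have hβd : 0 < β ^ d := Real.rpow_pos_of_pos hβ _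
  have hs2 : s^2 = c * β^d * bcoef α (n+1) := Real.sq_sqrt (by positivity)
  have hs0 : 0 < s := Real.sqrt_pos.2 (by positivity)
  have hw2 : v * ((2:ℝ)^(n+1) / r)^2 ≤ 1/(c * β^(d-1)) := by
    rw [hw, Real.rpow_sub_one hβ.ne']
    have : 1 / (c * (β^d / β)) = β * bcoef α (n+1) / s^2 := by
      rw [hs2]; field_simp
    rw [this]
    exact div_le_div_of_nonneg_left (by positivity) (by positivity)
      (pow_le_pow_left₀ hs0.le hr1.le 2)
  have hlog : Real.log r ≤ Real.log (1 + s) := Real.log_le_log hr0 hr2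
  set I1 := ∫ η, gibbs α β fh n η (fun σ => (totalSpin n σ)^2) ∂ gaussianFields (2^n)
  set I2 := ∫ η, gibbs α β fh (n+1) η (fun σ => (totalSpin (n+1) σ)^2) ∂ μ
  have f1 : fG α β fh (n+1-1) = ((2:ℝ)^(2*n))⁻¹ * I1 := rfl
  have f2 : fG α β fh (n+1) = ((2:ℝ)^(2*(n+1)))⁻¹ * I2 := rfl
  have g1 : 4 * v * I1 = β * bcoef α (n+1) * fG α β fh (n+1-1) := by
    rw [f1, hv, show 2*(n+1) = 2*n+2 by ring, pow_add]; field_simp; norm_num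
  have g2 : v * I2 = β * bcoef α (n+1) * fG α β fh (n+1) := by
    rw [f2, hv]; ring
  have hbb : 0 < β * bcoef α (n+1) := by positivity
  rw [ge_iff_le, sub_le_iff_le_add, ← sub_le_iff_le_add', one_div_mul_eq_div, le_div_iff₀ hbb]
  set IM := ∫ η, maxgk α β fh (n+1) r hr η ∂ μ
  set IL := ∫ η, Real.log (∑ σ, Real.exp (-β * dysonHRF α fh n η σ)) ∂ gaussianFields (2^n)
  have hint' : -(v * ((2:ℝ)^(n+1) / r)^2) - Real.log r - IM + 4 * v * I1 + IL - IL ≤ v * I2 := hint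
  rw [g1, g2] at hint'
  linarith

end
end

section
/- Fix α > 1, β > 0, h > 0, c > 0, d ≥ 0, and N ≥ 1, and let the random fields be i.i.d. standard Gaussian. Then E[ max_{1≤k≤r_N} log( Z_{k,1}(h₁)/Z_{k,2}(h₂) ) ] ≤ β h 2^{N/2} · log( (1 + (c β^d b_N)^{1/2}) · (1 + √(2πe)) ). -/
open MeasureTheory ProbabilityTheory Filter
open scoped Classical

noncomputable section

lemma aux_lint_exp (a : ℝ) : ∫⁻ s, ENNReal.ofReal (Real.exp (a * s)) ∂(gaussianReal 0 1)
    = ENNReal.ofReal (Real.exp (a^2/2)) := by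
  rw [← ofReal_integral_eq_lintegral_ofReal (integrable_exp_mul_gaussianReal a)
    (Filter.Eventually.of_forall fun x => (Real.exp_pos _).le)]
  have h := congrFun (mgf_id_gaussianReal (μ := 0) (v := 1)) a
  simp only [mgf, id] at h
  rw [h]; simp

lemma aux_ne_zero {Ω : Type*} [MeasurableSpace Ω] (μ : Measure Ω) [IsProbabilityMeasure μ]
    (u : Ω → ENNReal) (hu : Measurable u) (h0 : ∀ s, u s ≠ 0) : ∫⁻ s, u s ∂μ ≠ 0 := by
  have : 0 < ∫⁻ s, u s ∂μ := by
    rw [lintegral_pos_iff_support hu]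
    have : Function.support u = Set.univ := by ext s; simp [h0 s]
    rw [this]; simp
  exact this.ne'

lemma aux_one_dim (c : ℝ) (hc : 0 ≤ c) (u : ℝ → ENNReal) (hu : Measurable u) (h0 : ∀ s, u s ≠ 0)
    (ht : ∀ s, u s ≠ ⊤) (hL : ∀ s t, u s ≤ ENNReal.ofReal (Real.exp (c * |s - t|)) * u t) :
    (∫⁻ s, u s ∂(gaussianReal 0 1)) * (∫⁻ s, (u s)⁻¹ ∂(gaussianReal 0 1))
      ≤ ENNReal.ofReal (Real.exp (c^2)) := by
  set μ := gaussianReal 0 1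
  have hprod : (∫⁻ s, u s ∂μ) * (∫⁻ s, (u s)⁻¹ ∂μ)
      = ∫⁻ z : ℝ × ℝ, u z.1 * (u z.2)⁻¹ ∂(μ.prod μ) :=
    (lintegral_prod_mul hu.aemeasurable hu.inv.aemeasurable).symm
  have hprod2 : (∫⁻ s, u s ∂μ) * (∫⁻ s, (u s)⁻¹ ∂μ)
      = ∫⁻ z : ℝ × ℝ, (u z.1)⁻¹ * u z.2 ∂(μ.prod μ) := by
    rw [mul_comm]
    exact (lintegral_prod_mul hu.inv.aemeasurable hu.aemeasurable).symm
  have hpt : ∀ z : ℝ × ℝ, u z.1 * (u z.2)⁻¹ + (u z.1)⁻¹ * u z.2 ≤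
      ENNReal.ofReal (Real.exp (c * z.1)) * ENNReal.ofReal (Real.exp ((-c) * z.2))
      + ENNReal.ofReal (Real.exp ((-c) * z.1)) * ENNReal.ofReal (Real.exp (c * z.2)) := by
    rintro ⟨s, t⟩
    have hw : ∀ s, u s = ENNReal.ofReal (Real.exp (Real.log (u s).toReal)) := fun s => by
      rw [Real.exp_log (ENNReal.toReal_pos (h0 s) (ht s)), ENNReal.ofReal_toReal (ht s)]
    set w : ℝ → ℝ := fun s => Real.log (u s).toReal with hwdef
    have hw' : ∀ s, u s = ENNReal.ofReal (Real.exp (w s)) := hw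
    have hwi : ∀ s, (u s)⁻¹ = ENNReal.ofReal (Real.exp (- w s)) := fun s => by
      rw [hw' s, ← ENNReal.ofReal_inv_of_pos (Real.exp_pos _), Real.exp_neg]
    have hLw : ∀ s t, w s ≤ c * |s - t| + w t := fun s t => by
      have := hL s t
      rw [hw' s, hw' t, ← ENNReal.ofReal_mul (Real.exp_pos _).le, ← Real.exp_add,
        ENNReal.ofReal_le_ofReal_iff (Real.exp_pos _).le, Real.exp_le_exp] at this
      exact this
    have habs : |w s - w t| ≤ |c * (s - t)| := by
      rw [abs_mul, abs_of_nonneg hc, abs_le]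
      have h1 := hLw s t
      have h2 := hLw t s
      rw [abs_sub_comm] at h2
      constructor <;> linarith
    have hcosh := Real.cosh_le_cosh.2 habs
    rw [Real.cosh_eq, Real.cosh_eq] at hcosh
    simp only [hwi]
    rw [hw' s, hw' t]
    simp only [← ENNReal.ofReal_mul (Real.exp_pos _).le, ← Real.exp_add]
    rw [← ENNReal.ofReal_add (Real.exp_pos _).le (Real.exp_pos _).le,
      ← ENNReal.ofReal_add (Real.exp_pos _).le (Real.exp_pos _).le]
    apply ENNReal.ofReal_le_ofReal
    have e1 : w s + -w t = w s - w t := by ring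
    have e2 : -w s + w t = -(w s - w t) := by ring
    have e3 : c * s + -c * t = c * (s - t) := by ring
    have e4 : -c * s + c * t = -(c * (s - t)) := by ring
    rw [e1, e2, e3, e4]
    linarith
  have hme : ∀ a : ℝ, Measurable fun s : ℝ => ENNReal.ofReal (Real.exp (a * s)) := by
    intro a; fun_prop
  have hsum : (∫⁻ s, u s ∂μ) * (∫⁻ s, (u s)⁻¹ ∂μ) + (∫⁻ s, u s ∂μ) * (∫⁻ s, (u s)⁻¹ ∂μ)
      ≤ ENNReal.ofReal (Real.exp (c^2)) + ENNReal.ofReal (Real.exp (c^2)) := by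
    nth_rewrite 2 [hprod2]
    rw [hprod, ← lintegral_add_left (by fun_prop)]
    refine (lintegral_mono hpt).trans ?_
    rw [lintegral_add_left (by fun_prop), lintegral_prod_mul (hme _).aemeasurable (hme _).aemeasurable,
      lintegral_prod_mul (hme _).aemeasurable (hme _).aemeasurable]
    simp only [μ, aux_lint_exp]
    simp only [← ENNReal.ofReal_mul (Real.exp_pos _).le, ← Real.exp_add]
    have e1 : c^2/2 + (-c)^2/2 = c^2 := by ring
    have e2 : (-c)^2/2 + c^2/2 = c^2 := by ring
    rw [e1, e2]
  rw [← two_mul, ← two_mul] at hsum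
  exact (ENNReal.mul_le_mul_iff_right (by norm_num) (by norm_num)).1 hsum

lemma aux_key (c : ℝ) (hc : 0 ≤ c) (n : ℕ) : ∀ (f : (Fin n → ℝ) → ENNReal), Measurable f →
    (∀ x, f x ≠ 0) → (∀ x, f x ≠ ⊤) →
    (∀ x y, f x ≤ ENNReal.ofReal (Real.exp (c * ∑ i, |x i - y i|)) * f y) →
    (∫⁻ x, f x ∂(gaussianFields n)) * (∫⁻ x, (f x)⁻¹ ∂(gaussianFields n))
      ≤ ENNReal.ofReal (Real.exp (c^2)) ^ n := by
  induction n with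
  | zero =>
    intro f hf h0 ht hL
    have : ∀ F : (Fin 0 → ℝ) → ENNReal, ∫⁻ x, F x ∂(gaussianFields 0) = F default := by
      intro F
      rw [lintegral_unique]; simp [gaussianFields]
      exact congrArg F (Subsingleton.elim _ _)
    rw [this, this, ENNReal.mul_inv_cancel (h0 _) (ht _)]; simp
  | succ n ih =>
    intro f hf h0 ht hL
    set μ := gaussianReal 0 1
    have hmp := measurePreserving_piFinSuccAbove (fun _ : Fin (n+1) => μ) 0
    have hsymm := hmp.symm
    have hcons : Measurable fun z : ℝ × (Fin n → ℝ) => (Fin.cons z.1 z.2 : Fin (n+1) → ℝ) := by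
      refine measurable_pi_iff.2 fun i => ?_
      refine Fin.cases ?_ (fun j => ?_) i
      · simpa using measurable_fst
      · simp only [Fin.cons_succ]
        fun_prop
    have hsplit : ∀ F : (Fin (n+1) → ℝ) → ENNReal, Measurable F →
        ∫⁻ x, F x ∂(gaussianFields (n+1)) =
          ∫⁻ y, ∫⁻ t, F (Fin.cons t y) ∂μ ∂(gaussianFields n) := by
      intro F hF
      have h1 := hsymm.lintegral_comp hF
      have : gaussianFields (n+1) = Measure.pi fun _ => μ := rfl
      rw [this, ← h1]
      have h2 : ∀ z : ℝ × (Fin n → ℝ),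
          (MeasurableEquiv.piFinSuccAbove (fun _ : Fin (n+1) => ℝ) 0).symm z = Fin.cons z.1 z.2 := by
        intro z
        simp [MeasurableEquiv.piFinSuccAbove, Fin.insertNthEquiv]
      simp only [h2]
      exact lintegral_prod_symm (fun z : ℝ × (Fin n → ℝ) => F (Fin.cons z.1 z.2))
        (hF.comp hcons).aemeasurable
    set K := ENNReal.ofReal (Real.exp (c^2)) with hK
    have hsec : ∀ y : Fin n → ℝ, Measurable fun t : ℝ => f (Fin.cons t y) := fun y =>
      (hf.comp hcons).comp (measurable_id.prodMk measurable_const)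
    set g : (Fin n → ℝ) → ENNReal := fun y => ∫⁻ t, f (Fin.cons t y) ∂μ with hg
    have hgm : Measurable g := (hf.comp hcons).lintegral_prod_left'
    have h1d : ∀ y, g y * ∫⁻ t, (f (Fin.cons t y))⁻¹ ∂μ ≤ K := by
      intro y
      refine aux_one_dim c hc _ (hsec y) (fun _ => h0 _) (fun _ => ht _) ?_
      intro s t
      have := hL (Fin.cons s y) (Fin.cons t y)
      simpa [Fin.sum_univ_succ] using this
    have hg0 : ∀ y, g y ≠ 0 := fun y => aux_ne_zero μ _ (hsec y) (fun _ => h0 _)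
    have hgt : ∀ y, g y ≠ ⊤ := by
      intro y
      refine (ENNReal.lt_top_of_mul_ne_top_left (b := ∫⁻ t, (f (Fin.cons t y))⁻¹ ∂μ) ?_ ?_).ne
      · exact ((h1d y).trans_lt ENNReal.ofReal_lt_top).ne
      · exact aux_ne_zero μ _ (hsec y).inv (fun _ => ENNReal.inv_ne_zero.2 (ht _))
    have hgL : ∀ x y, g x ≤ ENNReal.ofReal (Real.exp (c * ∑ i, |x i - y i|)) * g y := by
      intro x y
      simp only [hg]
      rw [← lintegral_const_mul _ (hsec y)]
      refine lintegral_mono fun t => ?_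
      have := hL (Fin.cons t x) (Fin.cons t y)
      simpa [Fin.sum_univ_succ] using this
    have hi := ih g hgm hg0 hgt hgL
    rw [hsplit f hf, hsplit (fun x => (f x)⁻¹) hf.inv]
    have hinv : ∀ y, ∫⁻ t, (f (Fin.cons t y))⁻¹ ∂μ ≤ K * (g y)⁻¹ := by
      intro y
      rw [← div_eq_mul_inv, ENNReal.le_div_iff_mul_le (Or.inl (hg0 y)) (Or.inl (hgt y)), mul_comm]
      exact h1d y
    calc _ ≤ (∫⁻ y, g y ∂(gaussianFields n)) * ∫⁻ y, K * (g y)⁻¹ ∂(gaussianFields n) := by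
            gcongr with y
            exact hinv y
      _ = K * ((∫⁻ y, g y ∂(gaussianFields n)) * ∫⁻ y, (g y)⁻¹ ∂(gaussianFields n)) := by
            rw [lintegral_const_mul (f := fun y => (g y)⁻¹) _ hgm.inv]; ring
      _ ≤ K * K^n := by gcongr
      _ = K^(n+1) := by ring

lemma aux_spin_abs (b : Bool) : |spin b| = 1 := by
  unfold spin; split <;> simp

lemma aux_Z_lip (α β fh : ℝ) (hβ : 0 < β) (hfh : 0 < fh) (N r k : ℕ) (x y : Fin (2^(N-1)) → ℝ) :
    Zres α β fh N r k x ≤ Real.exp (β * fh * ∑ i, |x i - y i|) * Zres α β fh N r k y := by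
  unfold Zres
  rw [Finset.mul_sum]
  refine Finset.sum_le_sum fun σ _ => ?_
  split_ifs
  · rw [← Real.exp_add, Real.exp_le_exp]
    unfold dysonHRF
    have : ∑ i, x i * spin (σ i) - ∑ i, y i * spin (σ i) ≤ ∑ i, |x i - y i| := by
      rw [← Finset.sum_sub_distrib]
      refine Finset.sum_le_sum fun i _ => ?_
      calc _ = (x i - y i) * spin (σ i) := by ring
        _ ≤ |(x i - y i) * spin (σ i)| := le_abs_self _
        _ = _ := by rw [abs_mul, aux_spin_abs, mul_one]
    have h2 := mul_le_mul_of_nonneg_left this (mul_pos hβ hfh).le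
    linarith
  · simp

lemma aux_Z_pos (α β fh : ℝ) (N r k : ℕ) (h : ∃ σ, inBlock N r k (totalSpin (N-1) σ))
    (x : Fin (2^(N-1)) → ℝ) : 0 < Zres α β fh N r k x := by
  obtain ⟨σ, hσ⟩ := h
  unfold Zres
  refine Finset.sum_pos' (fun τ _ => ?_) ⟨σ, Finset.mem_univ _, ?_⟩
  · split_ifs
    · exact (Real.exp_pos _).le
    · exact le_rfl
  · rw [if_pos hσ]; exact Real.exp_pos _

lemma aux_Z_meas (α β fh : ℝ) (N r k : ℕ) : Measurable (Zres α β fh N r k) := by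
  unfold Zres
  refine Finset.measurable_fun_sum _ fun σ _ => ?_
  split_ifs
  · unfold dysonHRF
    fun_prop
  · exact measurable_const

lemma aux_halves (N : ℕ) (hN : 1 ≤ N) : MeasurePreserving (fun η => (half1 N η, half2 N η))
    (gaussianFields (2^N)) ((gaussianFields (2^(N-1))).prod (gaussianFields (2^(N-1)))) := by
  have hpow : 2^(N-1) + 2^(N-1) = 2^N := by
    obtain ⟨m, rfl⟩ : ∃ m, N = m + 1 := ⟨N - 1, by omega⟩
    simp [pow_succ]; omega
  let e : Fin (2^(N-1)) ⊕ Fin (2^(N-1)) ≃ Fin (2^N) := finSumFinEquiv.trans (finCongr hpow)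
  have h1 := (measurePreserving_piCongrLeft (fun _ : Fin (2^N) => gaussianReal 0 1) e).symm
  have h2 := measurePreserving_sumPiEquivProdPi
    (fun _ : Fin (2^(N-1)) ⊕ Fin (2^(N-1)) => gaussianReal 0 1)
  have h3 := h2.comp h1
  have : (fun η => (half1 N η, half2 N η)) =
      (MeasurableEquiv.sumPiEquivProdPi fun _ : Fin (2^(N-1)) ⊕ Fin (2^(N-1)) => ℝ) ∘
        (MeasurableEquiv.piCongrLeft (fun _ => ℝ) e).symm := by
    funext η
    refine Prod.ext ?_ ?_
    · funext i
      rfl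
    · funext i
      have hi : 2^(N-1) + i.1 < 2^N := by have := i.2; omega
      simp only [half2, dif_pos hi]
      rfl
  rw [this]
  exact h3

lemma aux_gk_meas (α β fh : ℝ) (N : ℕ) (hN : 1 ≤ N) (r k : ℕ) : Measurable (gk α β fh N r k) := by
  unfold gk
  have h := (aux_halves N hN).measurable
  exact Real.measurable_log.comp
    (((aux_Z_meas α β fh N r k).comp (measurable_fst.comp h)).div
      ((aux_Z_meas α β fh N r k).comp (measurable_snd.comp h)))

lemma aux_gk_mgf (α β fh : ℝ) (hβ : 0 < β) (hfh : 0 < fh) (N : ℕ) (hN : 1 ≤ N) (r k : ℕ) (l : ℝ)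
    (hl : 0 < l) : ∫⁻ η, ENNReal.ofReal (Real.exp (l * gk α β fh N r k η)) ∂(gaussianFields (2^N))
      ≤ ENNReal.ofReal (Real.exp ((l * (β * fh))^2)) ^ (2^(N-1)) := by
  by_cases h : ∃ σ, inBlock N r k (totalSpin (N-1) σ)
  · have hp := aux_Z_pos α β fh N r k h
    set f : (Fin (2^(N-1)) → ℝ) → ENNReal := fun x => ENNReal.ofReal (Zres α β fh N r k x ^ l) with hf
    have hfm : Measurable f := ((aux_Z_meas α β fh N r k).pow_const l).ennreal_ofReal
    have hkey := aux_key (l * (β * fh)) (by positivity) (2^(N-1)) f hfm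
      (fun x => by simp only [hf, ne_eq, ENNReal.ofReal_eq_zero, not_le]; exact Real.rpow_pos_of_pos (hp x) l)
      (fun x => ENNReal.ofReal_ne_top) (by
        intro x y
        simp only [hf]
        rw [← ENNReal.ofReal_mul (Real.exp_pos _).le]
        apply ENNReal.ofReal_le_ofReal
        refine (Real.rpow_le_rpow (hp x).le (aux_Z_lip α β fh hβ hfh N r k x y) hl.le).trans_eq ?_
        rw [Real.mul_rpow (Real.exp_pos _).le (hp y).le, ← Real.exp_mul]
        congr 2; ring)
    refine le_trans (le_of_eq ?_) hkey
    have hpr : IsProbabilityMeasure (gaussianFields (2^(N-1))) := by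
      unfold gaussianFields; infer_instance
    rw [← lintegral_prod_mul (g := fun x => (f x)⁻¹) hfm.aemeasurable hfm.inv.aemeasurable,
      ← (aux_halves N hN).lintegral_comp (f := fun z => f z.1 * (f z.2)⁻¹) (by fun_prop)]
    refine lintegral_congr fun η => ?_
    simp only [hf, gk]
    have p1 := hp (half1 N η)
    have p2 := hp (half2 N η)
    rw [← ENNReal.ofReal_inv_of_pos (Real.rpow_pos_of_pos p2 l),
      ← ENNReal.ofReal_mul (Real.rpow_pos_of_pos p1 l).le, ← div_eq_mul_inv,
      ← Real.div_rpow p1.le p2.le, Real.rpow_def_of_pos (div_pos p1 p2), mul_comm]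
  · have hz : ∀ x, Zres α β fh N r k x = 0 := by
      intro x
      unfold Zres
      refine Finset.sum_eq_zero fun σ _ => ?_
      rw [if_neg fun hσ => h ⟨σ, hσ⟩]
    simp only [gk, hz]
    have : IsProbabilityMeasure (gaussianFields (2^N)) := by unfold gaussianFields; infer_instance
    simp
    apply one_le_pow₀
    simp [sq_nonneg]

/-- Lemma 5 of the paper (gaussian random fields): bound on the expected maximum of
`log (Z_{k,1}/Z_{k,2})` over `1 ≤ k ≤ r_N`. -/
theorem rfim_dyson_maxlog_bound_gaussian (α β fh c d : ℝ) (hα : 1 < α) (hβ : 0 < β)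
    (hfh : 0 < fh) (hc : 0 < c) (hd : 0 ≤ d) (N : ℕ) (hN : 1 ≤ N) (r : ℕ) (hr : 1 ≤ r)
    (hr1 : Real.sqrt (c * β^d * bcoef α N) < (r:ℝ))
    (hr2 : (r:ℝ) ≤ 1 + Real.sqrt (c * β^d * bcoef α N)) :
    (∫ η, maxgk α β fh N r hr η ∂ gaussianFields (2^N)) ≤
      β * fh * (2:ℝ)^((N:ℝ)/2) *
        Real.log ((1 + Real.sqrt (c * β^d * bcoef α N)) * (1 + Real.sqrt (2 * Real.pi * Real.exp 1))) := by
  have hprob : IsProbabilityMeasure (gaussianFields (2^N)) := by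
    unfold gaussianFields; infer_instance
  set S := Real.sqrt (c * β^d * bcoef α N) with hS
  set T := Real.sqrt (2 * Real.pi * Real.exp 1) with hT
  have hS0 : 0 ≤ S := Real.sqrt_nonneg _
  have hT0 : 0 ≤ T := Real.sqrt_nonneg _
  set L := β * fh * (2:ℝ)^((N:ℝ)/2) with hLdef
  have hL : 0 < L := by positivity
  have hr0 : (1:ℝ) ≤ r := by exact_mod_cast hr
  set M : ℝ := r * Real.exp (1/2) with hM
  have hMpos : 0 < M := by positivity
  have hexpT : Real.exp (1/2) ≤ 1 + T := by
    have : Real.exp (1/2) ≤ T := by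
      apply Real.le_sqrt_of_sq_le
      rw [← Real.exp_nat_mul]
      have h1 : ((2:ℕ):ℝ) * (1/2) = 1 := by norm_num
      rw [h1]
      have := Real.pi_gt_three
      nlinarith [Real.exp_pos 1]
    linarith
  have hlogM : Real.log M ≤ Real.log ((1 + S) * (1 + T)) := by
    apply Real.log_le_log hMpos
    exact mul_le_mul hr2 hexpT (Real.exp_pos _).le (by linarith)
  have hlogM0 : 0 ≤ Real.log M := by
    apply Real.log_nonneg
    have : 1 ≤ Real.exp (1/2) := Real.one_le_exp (by norm_num)
    nlinarith
  by_cases hint : Integrable (maxgk α β fh N r hr) (gaussianFields (2^N))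
  swap
  · rw [integral_undef hint]
    exact mul_nonneg hL.le (hlogM0.trans hlogM)
  have hK : ENNReal.ofReal (Real.exp ((L⁻¹ * (β * fh))^2)) ^ (2^(N-1))
      = ENNReal.ofReal (Real.exp (1/2)) := by
    rw [← ENNReal.ofReal_pow (Real.exp_pos _).le, ← Real.exp_nat_mul]
    congr 2
    have h1 : L⁻¹ * (β * fh) = ((2:ℝ)^((N:ℝ)/2))⁻¹ := by
      rw [hLdef]; field_simp
    have h2 : ((2:ℝ)^((N:ℝ)/2))^2 = 2^N := by
      rw [← Real.rpow_natCast, ← Real.rpow_mul (by norm_num), ← Real.rpow_natCast]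
      congr 1; push_cast; ring
    rw [h1, inv_pow, h2]
    obtain ⟨m, rfl⟩ : ∃ m, N = m + 1 := ⟨N - 1, by omega⟩
    simp only [Nat.add_sub_cancel]
    push_cast
    rw [pow_succ]; field_simp
  have hmgf : ∀ k, ∫⁻ η, ENNReal.ofReal (Real.exp (L⁻¹ * gk α β fh N r k η)) ∂(gaussianFields (2^N))
      ≤ ENNReal.ofReal (Real.exp (1/2)) := fun k => by
    rw [← hK]
    exact aux_gk_mgf α β fh hβ hfh N hN r k L⁻¹ (inv_pos.2 hL)
  have hmeas : ∀ k, Measurable fun η => Real.exp (L⁻¹ * gk α β fh N r k η) := fun k =>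
    Real.measurable_exp.comp ((aux_gk_meas α β fh N hN r k).const_mul _)
  have hintk : ∀ k, Integrable (fun η => Real.exp (L⁻¹ * gk α β fh N r k η)) (gaussianFields (2^N)) := by
    intro k
    refine ⟨(hmeas k).aestronglyMeasurable, ?_⟩
    rw [hasFiniteIntegral_iff_ofReal (Filter.Eventually.of_forall fun _ => (Real.exp_pos _).le)]
    exact (hmgf k).trans_lt ENNReal.ofReal_lt_top
  have hEk : ∀ k, ∫ η, Real.exp (L⁻¹ * gk α β fh N r k η) ∂(gaussianFields (2^N)) ≤ Real.exp (1/2) := by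
    intro k
    rw [← ENNReal.ofReal_le_ofReal_iff (Real.exp_pos _).le,
      ofReal_integral_eq_lintegral_ofReal (hintk k)
        (Filter.Eventually.of_forall fun _ => (Real.exp_pos _).le)]
    exact hmgf k
  have hpt : ∀ η, maxgk α β fh N r hr η ≤ L * (Real.log M - 1 +
      M⁻¹ * ∑ k ∈ Finset.Icc 1 r, Real.exp (L⁻¹ * gk α β fh N r k η)) := by
    intro η
    obtain ⟨k, hk, hkeq⟩ := Finset.exists_mem_eq_sup' (Finset.nonempty_Icc.mpr hr)
      (fun k => gk α β fh N r k η)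
    unfold maxgk
    rw [hkeq]
    have h1 : Real.exp (L⁻¹ * gk α β fh N r k η) ≤
        ∑ k ∈ Finset.Icc 1 r, Real.exp (L⁻¹ * gk α β fh N r k η) :=
      Finset.single_le_sum (f := fun k => Real.exp (L⁻¹ * gk α β fh N r k η))
        (fun _ _ => (Real.exp_pos _).le) hk
    have h2 := Real.add_one_le_exp (L⁻¹ * gk α β fh N r k η - Real.log M)
    rw [Real.exp_sub, Real.exp_log hMpos, div_eq_inv_mul] at h2
    have h3 := mul_le_mul_of_nonneg_left h1 (inv_pos.2 hMpos).le
    have h4 : gk α β fh N r k η = L * (L⁻¹ * gk α β fh N r k η) := by field_simp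
    rw [h4]
    refine mul_le_mul_of_nonneg_left ?_ hL.le
    linarith
  have hintsum : Integrable (fun η => ∑ k ∈ Finset.Icc 1 r, Real.exp (L⁻¹ * gk α β fh N r k η))
      (gaussianFields (2^N)) := integrable_finsetSum _ fun k _ => hintk k
  have hle := integral_mono hint (((integrable_const (Real.log M - 1)).add
    (hintsum.const_mul M⁻¹)).const_mul L) hpt
  refine hle.trans ?_
  simp only [Pi.add_apply]
  rw [integral_const_mul, integral_add (integrable_const _) (hintsum.const_mul _),
    integral_const_mul, integral_finsetSum _ fun k _ => hintk k, integral_const]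
  refine mul_le_mul_of_nonneg_left ?_ hL.le
  have hsum : ∑ k ∈ Finset.Icc 1 r, ∫ η, Real.exp (L⁻¹ * gk α β fh N r k η) ∂(gaussianFields (2^N)) ≤ M := by
    refine (Finset.sum_le_sum fun k _ => hEk k).trans ?_
    simp [hM]
  have h5 : M⁻¹ * ∑ k ∈ Finset.Icc 1 r, ∫ η, Real.exp (L⁻¹ * gk α β fh N r k η) ∂(gaussianFields (2^N)) ≤ 1 := by
    rw [inv_mul_le_iff₀ hMpos]; linarith
  simp only [probReal_univ, one_smul]
  linarith

end
end
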